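/- arXiv:math/0403145 — 3 statements merged into one kernel-verified Lean document; each statement's English description precedes it below -/
import Mathlib

section
/- Let n ≥ 4 and let a, b ∈ B_n be half-twists (conjugates of σ_1). If a^j = b^k for some nonzero integers j and k, then a = b and j = k. -/
/-- Relators for the braid group with generators `σ_0, …, σ_{m-1}`:
the braid relations `σ_i σ_j σ_i = σ_j σ_i σ_j` for `j = i+1`, and the
commutation relations `σ_i σ_j = σ_j σ_i` for `j ≥ i+2`. -/
def braidRels (m : ℕ) : Set (FreeGroup (Fin m)) :=
  { r | ∃ i j : Fin m,
      ((i : ℕ) + 1 = (j : ℕ) ∧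
        r = FreeGroup.of i * FreeGroup.of j * FreeGroup.of i *
            (FreeGroup.of j * FreeGroup.of i * FreeGroup.of j)⁻¹) ∨
      ((i : ℕ) + 2 ≤ (j : ℕ) ∧
        r = FreeGroup.of i * FreeGroup.of j * (FreeGroup.of j * FreeGroup.of i)⁻¹) }

/-- The braid group on `n` strands: the presented group with generators
`σ_1, …, σ_{n-1}` (indexed by `Fin (n-1)`) and the braid relators. -/
abbrev BraidGroup (n : ℕ) : Type := PresentedGroup (braidRels (n - 1))

/-- The standard generator `σ_{i+1}` of the braid group (0-indexed). -/
def braidσ (n : ℕ) (i : Fin (n - 1)) : BraidGroup n := PresentedGroup.of i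

/-- The element `δ = σ_1 σ_2 ⋯ σ_{n-1}` of the braid group. -/
def braidδ (n : ℕ) : BraidGroup n := (List.ofFn (braidσ n)).prod

/-- The full twist `z = (σ_1 σ_2 ⋯ σ_{n-1})^n`. -/
def fullTwist (n : ℕ) : BraidGroup n := braidδ n ^ n

/-- Adjacency of generator indices. -/
def BraidAdj {N : ℕ} (i j : Fin N) : Prop := (i : ℕ) + 1 = j ∨ (j : ℕ) + 1 = i

/-- Generator indices at distance at least two. -/
def BraidFar {N : ℕ} (i j : Fin N) : Prop := (i : ℕ) + 2 ≤ j ∨ (j : ℕ) + 2 ≤ i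

theorem BraidFar.ne {i j : Fin N} (h : BraidFar i j) : i ≠ j := by
  rintro rfl
  unfold BraidFar at h
  omega

theorem BraidAdj.ne {i j : Fin N} (h : BraidAdj i j) : i ≠ j := by
  rintro rfl
  unfold BraidAdj at h
  omega

theorem BraidFar.not_adj {i j : Fin N} (h : BraidFar i j) : ¬ BraidAdj i j := by
  unfold BraidFar at h
  unfold BraidAdj
  omega

/-- One application of a braid relation to a positive word. -/
inductive BraidStep {N : ℕ} : List (Fin N) → List (Fin N) → Prop
  | braid {i j : Fin N} (h : BraidAdj i j) (w : List (Fin N)) :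
      BraidStep (i :: j :: i :: w) (j :: i :: j :: w)
  | comm {i j : Fin N} (h : BraidFar i j) (w : List (Fin N)) :
      BraidStep (i :: j :: w) (j :: i :: w)
  | cons (i : Fin N) {u v : List (Fin N)} (h : BraidStep u v) : BraidStep (i :: u) (i :: v)

theorem BraidAdj.symm {N : ℕ} {i j : Fin N} (h : BraidAdj i j) : BraidAdj j i := Or.symm h

theorem BraidFar.symm {N : ℕ} {i j : Fin N} (h : BraidFar i j) : BraidFar j i := Or.symm h

theorem braidIndex_trichotomy {N : ℕ} (i j : Fin N) : i = j ∨ BraidFar i j ∨ BraidAdj i j := by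
  unfold BraidFar BraidAdj
  rw [Fin.ext_iff]
  omega

namespace BraidStep

variable {N : ℕ} {u v : List (Fin N)}

theorem symm (h : BraidStep u v) : BraidStep v u := by
  induction h with
  | braid h w => exact .braid h.symm w
  | comm h w => exact .comm h.symm w
  | cons i _ ih => exact .cons i ih

theorem append_left (w : List (Fin N)) (h : BraidStep u v) : BraidStep (w ++ u) (w ++ v) := by
  induction w with
  | nil => exact h
  | cons i _ ih => exact .cons i ih

theorem append_right (w : List (Fin N)) (h : BraidStep u v) : BraidStep (u ++ w) (v ++ w) := by
  induction h with
  | braid h u => exact .braid h (u ++ w)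
  | comm h u => exact .comm h (u ++ w)
  | cons i _ ih => exact .cons i ih

end BraidStep

instance {N : ℕ} : Std.Symm (BraidStep (N := N)) := ⟨fun _ _ => BraidStep.symm⟩

/-- The congruence on positive words generated by the braid relations. -/
def braidCon (N : ℕ) : Con (FreeMonoid (Fin N)) where
  r u v := Relation.ReflTransGen BraidStep u.toList v.toList
  iseqv :=
    { refl := fun _ => .refl
      symm := Relation.ReflTransGen.stdSymm.symm _ _
      trans := fun h h' => h.trans h' }
  mul' := fun {_ u' v _} h h' =>
    (h.lift (· ++ v.toList) fun _ _ k => k.append_right _).trans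
      (h'.lift (u'.toList ++ ·) fun _ _ k => k.append_left _)

/-- The monoid of positive braids with generators `s_0, …, s_{N-1}`. -/
abbrev BraidMonoid (N : ℕ) : Type := (braidCon N).Quotient

namespace BraidMonoid

variable {N : ℕ}

/-- The class of a positive word. -/
def ofWord (w : List (Fin N)) : BraidMonoid N := ((FreeMonoid.ofList w : FreeMonoid (Fin N)) : _)

/-- The generators of the positive braid monoid. -/
def s (i : Fin N) : BraidMonoid N := ofWord [i]

theorem ofWord_nil : ofWord ([] : List (Fin N)) = 1 := rfl

theorem ofWord_cons (i : Fin N) (w : List (Fin N)) : ofWord (i :: w) = s i * ofWord w := rfl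

theorem ofWord_eq_iff {u v : List (Fin N)} :
    ofWord u = ofWord v ↔ Relation.ReflTransGen BraidStep u v :=
  (braidCon N).eq

theorem exists_ofWord (x : BraidMonoid N) : ∃ w, x = ofWord w :=
  Con.induction_on x fun w => ⟨w.toList, rfl⟩

theorem _root_.BraidStep.ofWord_eq {u v : List (Fin N)} (h : BraidStep u v) :
    ofWord u = ofWord v :=
  ofWord_eq_iff.2 (.single h)

theorem braid_assoc {a b : Fin N} (h : BraidAdj a b) (z : BraidMonoid N) :
    s a * (s b * (s a * z)) = s b * (s a * (s b * z)) := by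
  obtain ⟨w, rfl⟩ := exists_ofWord z
  exact (BraidStep.braid h w).ofWord_eq

theorem comm_assoc {a b : Fin N} (h : BraidFar a b) (z : BraidMonoid N) :
    s a * (s b * z) = s b * (s a * z) := by
  obtain ⟨w, rfl⟩ := exists_ofWord z
  exact (BraidStep.comm h w).ofWord_eq

/-- A function on the generators respecting the braid relations extends to the monoid. -/
def lift {P : Type*} [Monoid P] (f : Fin N → P)
    (hb : ∀ i j, BraidAdj i j → f i * f j * f i = f j * f i * f j)
    (hc : ∀ i j, BraidFar i j → f i * f j = f j * f i) : BraidMonoid N →* P :=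
  (braidCon N).lift (FreeMonoid.lift f) (by
    have key : ∀ u v : List (Fin N), BraidStep u v → (u.map f).prod = (v.map f).prod := by
      intro u v h
      induction h with
      | braid h w => simpa [mul_assoc] using congrArg (· * (w.map f).prod) (hb _ _ h)
      | comm h w => simpa [mul_assoc] using congrArg (· * (w.map f).prod) (hc _ _ h)
      | cons i _ ih => simp [ih]
    intro u v h
    rw [Con.ker_rel, FreeMonoid.lift_apply, FreeMonoid.lift_apply]
    change Relation.ReflTransGen BraidStep u.toList v.toList at h
    generalize u.toList = u, v.toList = v at h ⊢
    induction h with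
    | refl => rfl
    | tail _ h ih => exact ih.trans (key _ _ h))

@[simp] theorem lift_s {P : Type*} [Monoid P] (f : Fin N → P)
    (hb : ∀ i j, BraidAdj i j → f i * f j * f i = f j * f i * f j)
    (hc : ∀ i j, BraidFar i j → f i * f j = f j * f i) (i : Fin N) :
    lift f hb hc (s i) = f i :=
  FreeMonoid.lift_eval_of f i

theorem hom_ext {P : Type*} [Monoid P] {f g : BraidMonoid N →* P}
    (h : ∀ i, f (s i) = g (s i)) : f = g := by
  refine MonoidHom.ext fun x => ?_
  obtain ⟨w, rfl⟩ := exists_ofWord x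
  induction w with
  | nil => rw [ofWord_nil, map_one, map_one]
  | cons i w ih => rw [ofWord_cons, map_mul, map_mul, h, ih]

/-- The length of a positive braid. -/
def lengthHom (N : ℕ) : BraidMonoid N →* Multiplicative ℕ :=
  lift (fun _ => .ofAdd 1) (fun _ _ _ => rfl) (fun _ _ _ => rfl)

/-- The length of a positive braid, as a natural number. -/
def length (x : BraidMonoid N) : ℕ := (lengthHom N x).toAdd

@[simp] theorem length_mul (x y : BraidMonoid N) : length (x * y) = length x + length y := by
  simp [length]

@[simp] theorem length_one : length (1 : BraidMonoid N) = 0 := by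
  simp [length]

@[simp] theorem length_s (i : Fin N) : length (s i) = 1 := by
  simp [length, lengthHom]

/-- `Good a x c y` says that the equality `s a * x = s c * y` holds because both sides are
multiples of the least common multiple of `s a` and `s c`. -/
def Good (a : Fin N) (x : BraidMonoid N) (c : Fin N) (y : BraidMonoid N) : Prop :=
  (a = c ∧ x = y) ∨
  (BraidFar a c ∧ ∃ z, x = s c * z ∧ y = s a * z) ∨
  (BraidAdj a c ∧ ∃ z, x = s c * (s a * z) ∧ y = s a * (s c * z))

variable {a b c : Fin N} {w x y : BraidMonoid N}

theorem Good.symm (h : Good a x c y) : Good c y a x := by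
  rcases h with ⟨rfl, rfl⟩ | ⟨h, z, rfl, rfl⟩ | ⟨h, z, rfl, rfl⟩
  · exact .inl ⟨rfl, rfl⟩
  · exact .inr (.inl ⟨h.symm, z, rfl, rfl⟩)
  · exact .inr (.inr ⟨h.symm, z, rfl, rfl⟩)

theorem Good.length_eq (h : Good a x c y) : length x = length y := by
  rcases h with ⟨rfl, rfl⟩ | ⟨h, z, rfl, rfl⟩ | ⟨h, z, rfl, rfl⟩ <;> simp

theorem Good.eq (h : Good a x a y) : x = y := by
  rcases h with ⟨-, h⟩ | ⟨h, -⟩ | ⟨h, -⟩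
  · exact h
  · exact absurd rfl (BraidFar.ne h)
  · exact absurd rfl (BraidAdj.ne h)

theorem Good.exists_of_far (h : Good a x c y) (hac : BraidFar a c) :
    ∃ z, x = s c * z ∧ y = s a * z := by
  rcases h with ⟨h, -⟩ | ⟨-, h⟩ | ⟨h, -⟩
  · exact absurd h (BraidFar.ne hac)
  · exact h
  · exact absurd h (BraidFar.not_adj hac)

theorem Good.exists_of_adj (h : Good a x c y) (hac : BraidAdj a c) :
    ∃ z, x = s c * (s a * z) ∧ y = s a * (s c * z) := by
  rcases h with ⟨h, -⟩ | ⟨h, -⟩ | ⟨-, h⟩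
  · exact absurd h (BraidAdj.ne hac)
  · exact absurd hac (BraidFar.not_adj h)
  · exact h

/-- The case of `Good.trans` in which the first pair commutes and the second is adjacent. -/
theorem Good.trans_far_adj (hab : BraidFar a b) (hbc : BraidAdj b c) (hac : a ≠ c)
    (ih : ∀ (a c : Fin N) (x y : BraidMonoid N), length x < length w →
      s a * x = s c * y → Good a x c y)
    {z z' : BraidMonoid N} (hw : w = s a * z) (hw' : w = s c * (s b * z')) :
    Good a (s b * z) c (s b * (s c * z')) := by
  have hl : length w = length z + 1 := by rw [hw, length_mul, length_s, add_comm]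
  have hl' : length w = length z' + 2 := by rw [hw']; simp; omega
  have h₁ := ih a c z (s b * z') (by omega) (hw.symm.trans hw')
  rcases braidIndex_trichotomy a c with h | h | h
  · exact absurd h hac
  · obtain ⟨v, rfl, h₂⟩ := h₁.exists_of_far h
    obtain ⟨p, rfl, rfl⟩ := (ih b a z' v (by omega) h₂).exists_of_far hab.symm
    refine .inr (.inl ⟨h, s b * (s c * p), braid_assoc hbc p, ?_⟩)
    rw [← comm_assoc h, comm_assoc hab]
  · obtain ⟨v, rfl, h₂⟩ := h₁.exists_of_adj h
    obtain ⟨p, rfl, h₃⟩ := (ih b a z' _ (by omega) h₂).exists_of_far hab.symm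
    simp only [length_mul, length_s] at hl'
    obtain ⟨q, rfl, rfl⟩ := (ih c b v p (by simp at hl; omega) h₃).exists_of_adj hbc.symm
    refine .inr (.inr ⟨h, s b * (s c * (s a * q)), ?_, ?_⟩)
    · rw [comm_assoc hab, braid_assoc hbc, braid_assoc h.symm, comm_assoc hab.symm]
    · rw [braid_assoc h.symm, comm_assoc hab.symm, braid_assoc hbc.symm, ← comm_assoc hab]

theorem Good.trans
    (ih : ∀ (a c : Fin N) (x y : BraidMonoid N), length x < length w →
      s a * x = s c * y → Good a x c y)
    (h₁ : Good a x b w) (h₂ : Good b w c y) : Good a x c y := by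
  by_cases hac : a = c
  · subst hac
    refine .inl ⟨rfl, ?_⟩
    rcases h₁ with ⟨rfl, rfl⟩ | ⟨h, z, rfl, hw⟩ | ⟨h, z, rfl, hw⟩
    · exact h₂.eq
    · obtain ⟨z', hw', rfl⟩ := h₂.exists_of_far h.symm
      rw [(ih a a z z' (by simp [hw]) (hw.symm.trans hw')).eq]
    · obtain ⟨z', hw', rfl⟩ := h₂.exists_of_adj h.symm
      have h₃ := (ih a a _ _ (by simp [hw]) (hw.symm.trans hw')).eq
      rw [(ih b b z z' (by simp [hw]; omega) h₃).eq]
  rcases h₁ with ⟨rfl, rfl⟩ | ⟨hab, z, rfl, hw⟩ | ⟨hab, z, rfl, hw⟩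
  · exact h₂
  · rcases h₂ with ⟨rfl, rfl⟩ | ⟨hbc, z', hw', rfl⟩ | ⟨hbc, z', hw', rfl⟩
    · exact .inr (.inl ⟨hab, z, rfl, hw⟩)
    · have h₃ := ih a c z z' (by simp [hw]) (hw.symm.trans hw')
      rcases h₃ with ⟨h, -⟩ | ⟨h, v, rfl, rfl⟩ | ⟨h, v, rfl, rfl⟩
      · exact absurd h hac
      · exact .inr (.inl ⟨h, s b * v, comm_assoc hbc v, (comm_assoc hab v).symm⟩)
      · refine .inr (.inr ⟨h, s b * v, ?_, ?_⟩)
        · rw [comm_assoc hbc, comm_assoc hab]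
        · rw [← comm_assoc hab, comm_assoc hbc]
    · exact Good.trans_far_adj hab hbc hac ih hw hw'
  · rcases h₂ with ⟨rfl, rfl⟩ | ⟨hbc, z', hw', rfl⟩ | ⟨hbc, z', hw', rfl⟩
    · exact .inr (.inr ⟨hab, z, rfl, hw⟩)
    · exact (Good.trans_far_adj hbc.symm hab.symm (Ne.symm hac) ih hw' hw).symm
    · have h : BraidFar a c := by
        unfold BraidAdj at hab hbc
        unfold BraidFar
        rw [Fin.ext_iff] at hac
        omega
      obtain ⟨v, h₃, h₄⟩ :=
        (ih a c _ _ (by simp [hw]) (hw.symm.trans hw')).exists_of_far h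
      obtain ⟨p, rfl, rfl⟩ := (ih b c z v (by simp [hw]; omega) h₃).exists_of_adj hbc
      obtain ⟨q, rfl, h₅⟩ := (ih b a z' _ (by simp [hw']; omega) h₄).exists_of_adj hab.symm
      have h₆ := (ih b b _ _ (by simp [hw]; omega) h₅).eq
      obtain ⟨r, rfl, rfl⟩ := (ih c a p q (by simp [hw]; omega) h₆).exists_of_far h.symm
      refine .inr (.inl ⟨h, s b * (s c * (s a * (s b * r))), ?_, ?_⟩)
      · rw [comm_assoc h, braid_assoc hab, braid_assoc hbc]
      · rw [comm_assoc h.symm, braid_assoc hbc.symm, braid_assoc hab.symm, comm_assoc h]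

/-- Two generators dividing a positive braid have their least common multiple dividing it. -/
theorem good_of_eq {a c : Fin N} {x y : BraidMonoid N} (h : s a * x = s c * y) :
    Good a x c y := by
  induction hL : length x using Nat.strong_induction_on generalizing a c x y with
  | _ L ih =>
  obtain ⟨u, rfl⟩ := exists_ofWord x
  obtain ⟨v, rfl⟩ := exists_ofWord y
  rw [← ofWord_cons, ← ofWord_cons, ofWord_eq_iff] at h
  suffices H : ∀ t, Relation.ReflTransGen BraidStep (a :: u) t →
      ∃ b t', t = b :: t' ∧ Good a (ofWord u) b (ofWord t') by
    obtain ⟨b, t', ht, hg⟩ := H _ h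
    obtain ⟨rfl, rfl⟩ := List.cons_eq_cons.1 ht
    exact hg
  intro t ht
  induction ht with
  | refl => exact ⟨a, u, rfl, .inl ⟨rfl, rfl⟩⟩
  | tail _ hs ih' =>
    obtain ⟨b, t', rfl, hg⟩ := ih'
    have tr {d : Fin N} {q : List (Fin N)} (hd : Good b (ofWord t') d (ofWord q)) :
        Good a (ofWord u) d (ofWord q) :=
      hg.trans (fun _ _ _ _ hlt he => ih _ (by rw [← hL, hg.length_eq]; exact hlt) he rfl) hd
    cases hs with
    | braid h w => exact ⟨_, _, rfl, tr (.inr (.inr ⟨h, ofWord w, rfl, rfl⟩))⟩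
    | comm h w => exact ⟨_, _, rfl, tr (.inr (.inl ⟨h, ofWord w, rfl, rfl⟩))⟩
    | cons i h => exact ⟨_, _, rfl, tr (.inl ⟨rfl, h.ofWord_eq⟩)⟩

theorem s_mul_left_cancel (h : s a * x = s a * y) : x = y := (good_of_eq h).eq

theorem mul_left_cancel' (w : BraidMonoid N) (h : w * x = w * y) : x = y := by
  obtain ⟨u, rfl⟩ := exists_ofWord w
  induction u with
  | nil => simpa [ofWord_nil] using h
  | cons i u ih =>
    rw [ofWord_cons, mul_assoc, mul_assoc] at h
    exact ih (s_mul_left_cancel h)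

theorem exists_eq_of_s_mul_eq_pow_mul_of_far (h : BraidFar a c) (k : ℕ)
    (he : s c * y = s a ^ k * x) : ∃ z, x = s c * z := by
  induction k generalizing y with
  | zero => exact ⟨y, by simpa using he.symm⟩
  | succ k ih =>
    rw [pow_succ', mul_assoc] at he
    obtain ⟨z, -, hz⟩ := (good_of_eq he).exists_of_far h.symm
    exact ih hz.symm

theorem exists_eq_of_s_mul_eq_pow_mul_of_adj (h : BraidAdj a c) (k : ℕ)
    (he : s c * y = s a ^ (k + 1) * x) : ∃ z, x = s c * (s a * z) := by
  induction k generalizing y with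
  | zero =>
    rw [zero_add, pow_one] at he
    obtain ⟨z, -, hz⟩ := (good_of_eq he).exists_of_adj h.symm
    exact ⟨z, hz⟩
  | succ k ih =>
    rw [pow_succ', mul_assoc] at he
    obtain ⟨z, -, hz⟩ := (good_of_eq he).exists_of_adj h.symm
    exact ih hz.symm

theorem pow_s_injective {k : ℕ} (h : s a ^ (k + 1) = s c ^ (k + 1)) : a = c := by
  have he : s c * s c ^ k = s a ^ (k + 1) * 1 := by rw [mul_one, h, pow_succ']
  rcases braidIndex_trichotomy a c with h' | h' | h'
  · exact h'
  · obtain ⟨z, hz⟩ := exists_eq_of_s_mul_eq_pow_mul_of_far h' _ he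
    have := congrArg length hz
    simp only [length_mul, length_one, length_s] at this
    omega
  · obtain ⟨z, hz⟩ := exists_eq_of_s_mul_eq_pow_mul_of_adj h' _ he
    have := congrArg length hz
    simp only [length_mul, length_one, length_s] at this
    omega

theorem pow_mul_comm_of_adj (h : BraidAdj a c) (k : ℕ) (z : BraidMonoid N) :
    s a ^ k * (s c * (s a * z)) = s c * (s a * (s c ^ k * z)) := by
  induction k with
  | zero => simp
  | succ k ih => rw [pow_succ', mul_assoc, ih, braid_assoc h, pow_succ', mul_assoc]

theorem pow_mul_comm_of_far (h : BraidFar a c) (k : ℕ) (z : BraidMonoid N) :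
    s a ^ k * (s c * z) = s c * (s a ^ k * z) := by
  induction k with
  | zero => simp
  | succ k ih => rw [pow_succ', mul_assoc, ih, comm_assoc h, mul_assoc]

/-- A positive braid intertwining positive powers of two generators intertwines the generators. -/
theorem s_mul_eq_mul_s_of_pow {k : ℕ} (h : s a ^ (k + 1) * x = x * s b ^ (k + 1)) :
    s a * x = x * s b := by
  induction hL : length x using Nat.strong_induction_on generalizing a x with
  | _ L ih =>
  obtain ⟨u, rfl⟩ := exists_ofWord x
  cases u with
  | nil =>
    rw [ofWord_nil, one_mul, mul_one] at *
    rw [pow_s_injective h]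
  | cons c u =>
    rw [ofWord_cons] at *
    rcases braidIndex_trichotomy a c with rfl | hac | hac
    · rw [← mul_assoc, ← pow_succ, pow_succ', mul_assoc, mul_assoc] at h
      have h₁ := ih _ (by simp [← hL]) (s_mul_left_cancel h) rfl
      rw [h₁, ← mul_assoc, h₁]
    · rw [pow_mul_comm_of_far hac, mul_assoc] at h
      have h₁ := ih _ (by simp [← hL]) (s_mul_left_cancel h) rfl
      rw [comm_assoc hac, h₁, mul_assoc]
    · rw [mul_assoc (s c)] at h
      obtain ⟨z, hz⟩ := exists_eq_of_s_mul_eq_pow_mul_of_adj hac k h.symm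
      rw [← mul_assoc (s c), hz, pow_mul_comm_of_adj hac] at h
      simp only [mul_assoc] at h
      have hl : length z < L := by rw [← hL, hz]; simp; omega
      have h₁ := ih _ hl (s_mul_left_cancel (s_mul_left_cancel h)) rfl
      rw [hz, braid_assoc hac, h₁]
      simp only [mul_assoc]

end BraidMonoid

section CentralPower

variable {M : Type*} [Monoid M]

/-- The product `s 0 * s 1 * ⋯ * s (m - 1)`. -/
def prodRange (s : ℕ → M) : ℕ → M
  | 0 => 1
  | m + 1 => prodRange s m * s m

theorem prodRange_succ' (s : ℕ → M) (m : ℕ) :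
    prodRange s (m + 1) = s 0 * prodRange (fun i => s (i + 1)) m := by
  induction m with
  | zero => simp [prodRange]
  | succ m ih => rw [prodRange, ih, prodRange, mul_assoc]

variable {s : ℕ → M} {N : ℕ}

theorem prodRange_commute (hc : ∀ i j, i + 2 ≤ j → j < N → s i * s j = s j * s i)
    {m j : ℕ} (hm : m < j) (hj : j < N) : prodRange s m * s j = s j * prodRange s m := by
  induction m with
  | zero => simp [prodRange]
  | succ m ih =>
    rw [prodRange, mul_assoc, hc m j (by omega) hj, ← mul_assoc, ih (by omega), mul_assoc]

theorem prodRange_mul (hb : ∀ i, i + 1 < N → s i * s (i + 1) * s i = s (i + 1) * s i * s (i + 1))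
    (hc : ∀ i j, i + 2 ≤ j → j < N → s i * s j = s j * s i)
    {m i : ℕ} (hi : i + 1 < m) (hm : m ≤ N) :
    prodRange s m * s i = s (i + 1) * prodRange s m := by
  induction m with
  | zero => omega
  | succ m ih =>
    rcases Nat.lt_or_ge (i + 1) m with h | h
    · rw [prodRange, mul_assoc, ← hc i m (by omega) (by omega), ← mul_assoc, ih h (by omega),
        mul_assoc]
    · obtain rfl : m = i + 1 := by omega
      have := hb i (by omega)
      simp only [prodRange, mul_assoc] at this ⊢
      rw [this, ← mul_assoc, prodRange_commute hc (by omega) (by omega), mul_assoc]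

theorem prodRange_mul_prodRange
    (hb : ∀ i, i + 1 < N → s i * s (i + 1) * s i = s (i + 1) * s i * s (i + 1))
    (hc : ∀ i j, i + 2 ≤ j → j < N → s i * s j = s j * s i) {m : ℕ} (hm : m < N) :
    prodRange s N * prodRange s m = prodRange (fun i => s (i + 1)) m * prodRange s N := by
  induction m with
  | zero => simp [prodRange]
  | succ m ih =>
    rw [prodRange, ← mul_assoc, ih (by omega), mul_assoc, prodRange_mul hb hc hm le_rfl,
      prodRange, mul_assoc]

theorem prodRange_pow_mul
    (hb : ∀ i, i + 1 < N → s i * s (i + 1) * s i = s (i + 1) * s i * s (i + 1))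
    (hc : ∀ i j, i + 2 ≤ j → j < N → s i * s j = s j * s i) {i t : ℕ} (h : i + t < N) :
    prodRange s N ^ t * s i = s (i + t) * prodRange s N ^ t := by
  induction t with
  | zero => simp
  | succ t ih =>
    rw [pow_succ', mul_assoc, ih (by omega), ← mul_assoc,
      prodRange_mul hb hc (by omega) le_rfl, mul_assoc, add_assoc]

theorem prodRange_sq_mul {K : ℕ}
    (hb : ∀ i, i + 1 < K + 1 → s i * s (i + 1) * s i = s (i + 1) * s i * s (i + 1))
    (hc : ∀ i j, i + 2 ≤ j → j < K + 1 → s i * s j = s j * s i) :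
    prodRange s (K + 1) ^ 2 * s K = s 0 * prodRange s (K + 1) ^ 2 := by
  have h := prodRange_mul_prodRange hb hc (Nat.lt_succ_self K)
  set d := prodRange s (K + 1) with hd
  have h₁ : d = prodRange s K * s K := rfl
  have h₂ : d = s 0 * prodRange (fun i => s (i + 1)) K := prodRange_succ' s K
  calc d ^ 2 * s K = d * (d * s K) := by rw [sq, mul_assoc]
    _ = s 0 * (prodRange (fun i => s (i + 1)) K * d) * s K := by
        conv_lhs => enter [1]; rw [h₂]
        simp only [mul_assoc]
    _ = s 0 * (d * (prodRange s K * s K)) := by rw [← h]; simp only [mul_assoc]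
    _ = s 0 * d ^ 2 := by rw [← h₁, sq]

/-- The power `(s 0 * ⋯ * s (N - 1)) ^ (N + 1)` is central. -/
theorem prodRange_pow_commute
    (hb : ∀ i, i + 1 < N → s i * s (i + 1) * s i = s (i + 1) * s i * s (i + 1))
    (hc : ∀ i j, i + 2 ≤ j → j < N → s i * s j = s j * s i) {i : ℕ} (hi : i < N) :
    prodRange s N ^ (N + 1) * s i = s i * prodRange s N ^ (N + 1) := by
  obtain ⟨t, rfl⟩ : ∃ t, N = i + t + 1 := ⟨N - i - 1, by omega⟩
  have h₁ := prodRange_pow_mul hb hc (i := i) (t := t) (by omega)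
  have h₂ := prodRange_sq_mul hb hc
  have h₃ := prodRange_pow_mul hb hc (i := 0) (t := i) (by omega)
  rw [zero_add] at h₃
  set d := prodRange s (i + t + 1)
  have h₄ : d ^ (i + t + 1 + 1) = d ^ i * (d ^ 2 * d ^ t) := by
    rw [← pow_add, ← pow_add]; congr 1; omega
  rw [h₄, mul_assoc, mul_assoc, h₁, ← mul_assoc (d ^ 2), h₂, mul_assoc, ← mul_assoc (d ^ i), h₃,
    mul_assoc]

theorem exists_mul_eq_prodRange_pow
    (hb : ∀ i, i + 1 < N → s i * s (i + 1) * s i = s (i + 1) * s i * s (i + 1))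
    (hc : ∀ i j, i + 2 ≤ j → j < N → s i * s j = s j * s i) {i : ℕ} (hi : i < N) :
    ∃ u, s i * u = prodRange s N ^ (N + 1) := by
  have h := prodRange_pow_mul hb hc (i := 0) (t := i) (by omega)
  obtain ⟨t, rfl⟩ : ∃ t, N = i + t + 1 := ⟨N - i - 1, by omega⟩
  rw [zero_add] at h
  have h₂ := prodRange_succ' s (i + t)
  set d := prodRange s (i + t + 1)
  have h₄ : d ^ (i + t + 1 + 1) = d ^ i * (d * d ^ (t + 1)) := by
    rw [← pow_succ', ← pow_add]; congr 1
  refine ⟨d ^ i * (prodRange (fun i => s (i + 1)) (i + t) * d ^ (t + 1)), ?_⟩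
  rw [h₄]
  nth_rw 4 [h₂]
  rw [← mul_assoc, ← h]
  simp only [mul_assoc]

end CentralPower

namespace BraidMonoid

variable {N : ℕ}

theorem braid_relation {i j : Fin N} (h : BraidAdj i j) : s i * s j * s i = s j * s i * s j := by
  simpa [mul_assoc] using braid_assoc h 1

theorem comm_relation {i j : Fin N} (h : BraidFar i j) : s i * s j = s j * s i := by
  simpa using comm_assoc h 1

/-- There is a central positive braid divisible by all generators. -/
theorem exists_central (N : ℕ) : ∃ z : BraidMonoid N, (∀ x, z * x = x * z) ∧
    ∀ i, ∃ u, s i * u = z ∧ u * s i = z := by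
  let f : ℕ → BraidMonoid N := fun i => if h : i < N then s ⟨i, h⟩ else 1
  have hf : ∀ i : Fin N, f i = s i := fun i => dif_pos i.2
  have hb : ∀ i, i + 1 < N → f i * f (i + 1) * f i = f (i + 1) * f i * f (i + 1) := by
    intro i hi
    rw [hf ⟨i, by omega⟩, hf ⟨i + 1, hi⟩]
    exact braid_relation (.inl rfl)
  have hc : ∀ i j, i + 2 ≤ j → j < N → f i * f j = f j * f i := by
    intro i j hij hj
    rw [hf ⟨i, by omega⟩, hf ⟨j, hj⟩]
    exact comm_relation (.inl hij)
  have hz : ∀ x : BraidMonoid N, prodRange f N ^ (N + 1) * x = x * prodRange f N ^ (N + 1) := by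
    intro x
    obtain ⟨w, rfl⟩ := exists_ofWord x
    induction w with
    | nil => rw [ofWord_nil, one_mul, mul_one]
    | cons i w ih =>
      rw [ofWord_cons, ← mul_assoc, ← hf, prodRange_pow_commute hb hc i.2, mul_assoc, ih, mul_assoc]
  refine ⟨_, hz, fun i => ?_⟩
  obtain ⟨u, hu⟩ := exists_mul_eq_prodRange_pow hb hc i.2
  rw [hf] at hu
  refine ⟨u, hu, mul_left_cancel' (s i) ?_⟩
  rw [← mul_assoc, hu, hz]

/-- Powers of a central element form an Ore set. -/
abbrev oreSetPowers {M : Type*} [Monoid M] (z : M) (hz : ∀ x, z * x = x * z) :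
    OreLocalization.OreSet (Submonoid.powers z) :=
  have hp : ∀ (t : Submonoid.powers z) (x : M), t * x = x * t := by
    rintro ⟨_, m, rfl⟩ x
    exact (Commute.pow_left (hz x) m).eq
  { ore_right_cancel := fun r₁ r₂ t h => ⟨t, by rw [hp, hp, h]⟩
    oreNum := fun r _ => r
    oreDenom := fun _ t => t
    ore_eq := fun r t => hp t r }

open OreLocalization in
/-- The positive braid monoid embeds in a monoid where all generators are invertible. -/
theorem exists_embedding (N : ℕ) : ∃ (P : Type) (_ : Monoid P) (f : BraidMonoid N →* P),
    Function.Injective f ∧ ∀ i, IsUnit (f (s i)) := by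
  obtain ⟨z, hz, hu⟩ := exists_central N
  let _ := oreSetPowers z hz
  refine ⟨OreLocalization (Submonoid.powers z) (BraidMonoid N), inferInstance, numeratorHom,
    ?_, fun i => ?_⟩
  · intro x y h
    obtain ⟨u, v, h₁, h₂⟩ := oreDiv_eq_iff.1 h
    simp only [Submonoid.coe_one, mul_one] at h₂
    rw [← h₂] at h₁
    exact (mul_left_cancel' _ h₁).symm
  · obtain ⟨u, h₁, h₂⟩ := hu i
    let f : BraidMonoid N →* OreLocalization (Submonoid.powers z) (BraidMonoid N) := numeratorHom
    obtain ⟨c, hc⟩ : IsUnit (f z) := numerator_isUnit ⟨z, Submonoid.mem_powers z⟩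
    refine isUnit_iff_exists_and_exists.2 ⟨⟨f u * ↑c⁻¹, ?_⟩, ⟨↑c⁻¹ * f u, ?_⟩⟩
    · change f (s i) * _ = 1
      rw [← mul_assoc, ← map_mul, h₁, ← hc, Units.mul_inv]
    · change _ * f (s i) = 1
      rw [mul_assoc, ← map_mul, h₂, ← hc, Units.inv_mul]

end BraidMonoid

namespace BraidGroup

/-- A function on the generators respecting the braid relations extends to the braid group. -/
theorem exists_lift {n : ℕ} {G : Type*} [Group G] (f : Fin (n - 1) → G)
    (hb : ∀ i j, BraidAdj i j → f i * f j * f i = f j * f i * f j)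
    (hc : ∀ i j, BraidFar i j → f i * f j = f j * f i) :
    ∃ φ : BraidGroup n →* G, ∀ i, φ (braidσ n i) = f i := by
  have h : ∀ r ∈ braidRels (n - 1), FreeGroup.lift f r = 1 := by
    rintro r ⟨i, j, ⟨hij, rfl⟩ | ⟨hij, rfl⟩⟩
    · rw [map_mul, map_inv, mul_inv_eq_one]
      simpa using hb i j (.inl hij)
    · rw [map_mul, map_inv, mul_inv_eq_one]
      simpa using hc i j (.inl hij)
  exact ⟨PresentedGroup.toGroup h, fun i => PresentedGroup.toGroup.of h⟩

variable {n : ℕ}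

theorem braid_relation_of_lt {i j : Fin (n - 1)} (h : (i : ℕ) + 1 = j) :
    braidσ n i * braidσ n j * braidσ n i = braidσ n j * braidσ n i * braidσ n j :=
  mul_inv_eq_one.1
    ((QuotientGroup.eq_one_iff _).2 (Subgroup.subset_normalClosure ⟨i, j, .inl ⟨h, rfl⟩⟩))

theorem comm_relation_of_lt {i j : Fin (n - 1)} (h : (i : ℕ) + 2 ≤ j) :
    braidσ n i * braidσ n j = braidσ n j * braidσ n i :=
  mul_inv_eq_one.1
    ((QuotientGroup.eq_one_iff _).2 (Subgroup.subset_normalClosure ⟨i, j, .inr ⟨h, rfl⟩⟩))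

/-- The canonical homomorphism from positive braids to braids. -/
def ofPositive (n : ℕ) : BraidMonoid (n - 1) →* BraidGroup n :=
  BraidMonoid.lift (braidσ n)
    (fun _ _ h => h.elim braid_relation_of_lt fun h => (braid_relation_of_lt h).symm)
    (fun _ _ h => h.elim comm_relation_of_lt fun h => (comm_relation_of_lt h).symm)

@[simp] theorem ofPositive_s (i : Fin (n - 1)) : ofPositive n (BraidMonoid.s i) = braidσ n i :=
  BraidMonoid.lift_s _ _ _ i

theorem ofPositive_injective (n : ℕ) : Function.Injective (ofPositive n) := by
  obtain ⟨P, _, f, hf, hu⟩ := BraidMonoid.exists_embedding (n - 1)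
  choose v hv using hu
  obtain ⟨φ, hφ⟩ := exists_lift (n := n) v
    (fun i j h => Units.ext (by
      simpa [hv] using congrArg f (BraidMonoid.braid_relation h)))
    (fun i j h => Units.ext (by
      simpa [hv] using congrArg f (BraidMonoid.comm_relation h)))
  have h : ((Units.coeHom P).comp φ).comp (ofPositive n) = f :=
    BraidMonoid.hom_ext fun i => by simp [hφ, hv]
  intro x y hxy
  apply hf
  rw [← h]
  simp [hxy]

/-- Every braid is the quotient of a positive braid by a central element. -/
theorem exists_central_mul_eq_ofPositive (g : BraidGroup n) :
    ∃ z ∈ Subgroup.center (BraidGroup n), ∃ x, z * g = ofPositive n x := by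
  obtain ⟨z, hz, hu⟩ := BraidMonoid.exists_central (n - 1)
  have hg : g ∈ Subgroup.closure (Set.range (braidσ n)) := by
    have := PresentedGroup.closure_range_of (braidRels (n - 1))
    exact (SetLike.ext_iff.1 this g).2 trivial
  have hzc : ofPositive n z ∈ Subgroup.center (BraidGroup n) := by
    rw [← Subgroup.centralizer_univ, ← Subgroup.coe_top,
      ← PresentedGroup.closure_range_of (braidRels (n - 1)), Subgroup.centralizer_closure]
    rintro _ ⟨i, rfl⟩
    have h := congrArg (ofPositive n) (hz (BraidMonoid.s i)).symm
    rwa [map_mul, map_mul, ofPositive_s] at h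
  induction hg using Subgroup.closure_induction'' with
  | mem _ h =>
    obtain ⟨i, rfl⟩ := h
    exact ⟨1, one_mem _, BraidMonoid.s i, by simp⟩
  | one => exact ⟨1, one_mem _, 1, by simp⟩
  | mul g h _ _ ihg ihh =>
    obtain ⟨c, hc, x, hx⟩ := ihg
    obtain ⟨d, hd, y, hy⟩ := ihh
    refine ⟨c * d, mul_mem hc hd, x * y, ?_⟩
    rw [map_mul, ← hx, ← hy, mul_assoc, mul_assoc, ← mul_assoc d,
      ← Subgroup.mem_center_iff.1 hd g, mul_assoc]
  | inv_mem _ h =>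
    obtain ⟨i, rfl⟩ := h
    obtain ⟨u, -, h₂⟩ := hu i
    exact ⟨_, hzc, u, by rw [← h₂, map_mul, ofPositive_s, mul_inv_cancel_right]⟩

/-- A braid intertwining nonzero powers of two generators intertwines the generators. -/
theorem mul_eq_mul_of_pow_mul_eq {i j : Fin (n - 1)} {k : ℕ} (hk : k ≠ 0) {g : BraidGroup n}
    (h : braidσ n i ^ k * g = g * braidσ n j ^ k) : braidσ n i * g = g * braidσ n j := by
  obtain ⟨k, rfl⟩ := Nat.exists_eq_succ_of_ne_zero hk
  obtain ⟨z, hz, x, hx⟩ := exists_central_mul_eq_ofPositive g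
  have hz' (y : BraidGroup n) : y * (z * g) = z * (y * g) := by
    rw [← mul_assoc, Subgroup.mem_center_iff.1 hz, mul_assoc]
  have hx' : BraidMonoid.s i * x = x * BraidMonoid.s j := by
    apply BraidMonoid.s_mul_eq_mul_s_of_pow (k := k)
    apply ofPositive_injective n
    rw [map_mul, map_mul, map_pow, map_pow, ofPositive_s, ofPositive_s, ← hx, hz', h, mul_assoc]
  have := congrArg (ofPositive n) hx'
  rw [map_mul, map_mul, ofPositive_s, ofPositive_s, ← hx, hz', mul_assoc] at this
  exact mul_left_cancel this

/-- Conjugates of generators with a common nonzero power are equal. -/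
theorem eq_of_isConj_of_pow_eq {i : Fin (n - 1)} {a b : BraidGroup n}
    (ha : IsConj (braidσ n i) a) (hb : IsConj (braidσ n i) b) {k : ℕ} (hk : k ≠ 0)
    (h : a ^ k = b ^ k) : a = b := by
  obtain ⟨x, rfl⟩ := isConj_iff.1 ha
  obtain ⟨y, rfl⟩ := isConj_iff.1 hb
  have key (c : BraidGroup n) :
      x * c * x⁻¹ = y * c * y⁻¹ ↔ c * (x⁻¹ * y) = x⁻¹ * y * c := by
    rw [← mul_right_inj x⁻¹, ← mul_left_inj y]
    simp only [mul_assoc, inv_mul_cancel_left, inv_mul_cancel, mul_one]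
  rw [conj_pow, conj_pow, key] at h
  exact (key _).2 (mul_eq_mul_of_pow_mul_eq hk h)

/-- The exponent sum of a braid. -/
theorem exists_exponentSum (n : ℕ) :
    ∃ φ : BraidGroup n →* Multiplicative ℤ, ∀ i, φ (braidσ n i) = .ofAdd 1 :=
  exists_lift (fun _ => Multiplicative.ofAdd 1) (fun _ _ _ => rfl) (fun _ _ _ => rfl)

end BraidGroup

/-- For `n ≥ 4` and half-twists `a, b` in `B_n` (conjugates of `σ_1`),
if `a^j = b^k` with `j, k` nonzero, then `a = b` and `j = k`. -/
theorem braidGroup_halfTwist_unique_power (n : ℕ) (hn : 4 ≤ n)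
    (a b : BraidGroup n)
    (ha : IsConj (braidσ n ⟨0, by omega⟩) a)
    (hb : IsConj (braidσ n ⟨0, by omega⟩) b)
    (j k : ℤ) (hj : j ≠ 0) (hk : k ≠ 0)
    (h : a ^ j = b ^ k) : a = b ∧ j = k := by
  obtain ⟨φ, hφ⟩ := BraidGroup.exists_exponentSum n
  have hconj {c : BraidGroup n} (hc : IsConj (braidσ n ⟨0, by omega⟩) c) : φ c = .ofAdd 1 := by
    rw [← isConj_iff_eq.1 (φ.map_isConj hc), hφ]
  have hjk : j = k := by
    have := congrArg φ h
    rw [map_zpow, map_zpow, hconj ha, hconj hb, ← ofAdd_zsmul, ← ofAdd_zsmul] at this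
    simpa using this
  subst hjk
  refine ⟨BraidGroup.eq_of_isConj_of_pow_eq ha hb (Int.natAbs_ne_zero.2 hj) ?_, rfl⟩
  rcases Int.natAbs_eq j with hn' | hn' <;> rw [hn'] at h
  · simpa only [zpow_natCast] using h
  · simpa only [zpow_neg, zpow_natCast, inv_inj] using h
end

section
/- Let n ≥ 4 and let a, b ∈ B_n be distinct half-twists (conjugates of σ_1). If a^j·b^k·a^j = b^k·a^j·b^k for some nonzero integers j and k, then j = k = 1 or j = k = −1. -/
/-- The centralizer of a positive power of a free generator consists of powers of the generator. -/
theorem FreeGroup.exists_eq_zpow_of_commute_pow {α : Type*} [DecidableEq α] (x : α) {k : ℕ}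
    (hk : 0 < k) (w : FreeGroup α) (hw : Commute w (FreeGroup.of x ^ k)) :
    ∃ m : ℤ, w = FreeGroup.of x ^ m := by
  induction hL : w.toWord.length using Nat.strong_induction_on generalizing w with
  | _ l ih =>
  rcases hc : w.toWord with _ | ⟨⟨y, c⟩, L⟩
  · exact ⟨0, by simpa using hc⟩
  have hwL : w = FreeGroup.mk [(y, c)] * FreeGroup.mk L := by
    rw [FreeGroup.mul_mk, List.singleton_append, ← hc, FreeGroup.mk_toWord]
  by_cases hy : y = x
  · subst hy
    obtain ⟨e, he⟩ : ∃ e : ℤ, FreeGroup.mk [(y, c)] = FreeGroup.of y ^ e := by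
      cases c
      · exact ⟨-1, by simp [FreeGroup.of, FreeGroup.inv_mk, FreeGroup.invRev]⟩
      · exact ⟨1, by simp [FreeGroup.of]⟩
    have hL' : FreeGroup.mk L = FreeGroup.of y ^ (-e) * w := by
      rw [hwL, he]; group
    obtain ⟨m, hm⟩ := ih (FreeGroup.mk L).toWord.length
      (by
        have h1 := FreeGroup.norm_mk_le (L₁ := L)
        rw [FreeGroup.norm] at h1
        rw [hc, List.length_cons] at hL
        omega) (FreeGroup.mk L)
      (by
        rw [hL']
        exact ((Commute.refl (FreeGroup.of y)).zpow_left _ |>.pow_right _).mul_left hw) rfl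
    exact ⟨e + m, by rw [hwL, he, hm, zpow_add]⟩
  · exfalso
    have hred : FreeGroup.IsReduced (List.replicate k (x, true) ++ w.toWord) := by
      rw [FreeGroup.IsReduced, List.isChain_append]
      refine ⟨?_, FreeGroup.isReduced_toWord, ?_⟩
      · exact List.isChain_replicate_of_rel _ (fun _ => rfl)
      · intro p hp q hq hpq
        rw [hc] at hq
        have h1 : p = (x, true) := List.eq_of_mem_replicate (List.mem_of_mem_getLast? hp)
        simp only [List.head?_cons, Option.mem_def, Option.some.injEq] at hq
        subst h1 hq
        exact absurd hpq.symm hy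
    have hX : (FreeGroup.of x ^ k).toWord = List.replicate k (x, true) :=
      FreeGroup.toWord_of_pow x k
    have h1 : (FreeGroup.of x ^ k * w).toWord = List.replicate k (x, true) ++ w.toWord := by
      rw [FreeGroup.toWord_mul, hX, hred.reduce_eq]
    have h2 := FreeGroup.toWord_mul_sublist w (FreeGroup.of x ^ k)
    rw [hw.eq, h1, hX] at h2
    have h3 := h2.eq_of_length (by simp [add_comm])
    obtain ⟨k, rfl⟩ := Nat.exists_eq_succ_of_ne_zero hk.ne'
    rw [hc, List.replicate_succ] at h3
    simp only [List.cons_append, List.cons.injEq, Prod.mk.injEq] at h3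
    exact hy h3.1.1.symm

theorem FreeGroup.exists_eq_zpow_of_commute_zpow {α : Type*} (x : α) {k : ℤ}
    (hk : k ≠ 0) {w : FreeGroup α} (hw : Commute w (FreeGroup.of x ^ k)) :
    ∃ m : ℤ, w = FreeGroup.of x ^ m := by
  classical
  refine FreeGroup.exists_eq_zpow_of_commute_pow x (Int.natAbs_pos.mpr hk) w ?_
  rw [← zpow_natCast, Int.natCast_natAbs]
  rcases abs_choice k with h | h <;> rw [h]
  · exact hw
  · rw [zpow_neg]; exact hw.inv_right

/-- If a nontrivial `ζ` commutes with `X ^ k` and with `γ * X ^ k * γ⁻¹` for a free generator `X`,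
then `γ` is a power of `X`. -/
theorem FreeGroup.exists_eq_zpow_of_commute_conj {α : Type*} (x : α) {k : ℤ} (hk : k ≠ 0)
    {γ ζ : FreeGroup α} (h₁ : Commute ζ (FreeGroup.of x ^ k))
    (h₂ : Commute ζ (γ * FreeGroup.of x ^ k * γ⁻¹)) (hζ : ζ ≠ 1) :
    ∃ m : ℤ, γ = FreeGroup.of x ^ m := by
  classical
  obtain ⟨m, hm⟩ := FreeGroup.exists_eq_zpow_of_commute_zpow x hk h₁
  have h₃ : Commute (γ⁻¹ * ζ * γ) (FreeGroup.of x ^ k) := by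
    have := (Commute.conj_iff γ⁻¹).mpr h₂
    simpa [mul_assoc] using this
  obtain ⟨m', hm'⟩ := FreeGroup.exists_eq_zpow_of_commute_zpow x hk h₃
  let e : FreeGroup α →* Multiplicative ℤ :=
    FreeGroup.lift (fun _ => Multiplicative.ofAdd 1)
  have hmm : m' = m := by
    have h4 : e (γ⁻¹ * ζ * γ) = e ζ := by
      rw [_root_.map_mul, _root_.map_mul, _root_.map_inv, mul_comm, mul_inv_cancel_left]
    rw [hm', hm] at h4
    simpa [e, ← ofAdd_zsmul] using h4
  have hm0 : m ≠ 0 := by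
    rintro rfl
    exact hζ (by simpa using hm)
  refine FreeGroup.exists_eq_zpow_of_commute_zpow x hm0 ?_
  rw [hmm, hm] at hm'
  rw [Commute, SemiconjBy]
  nth_rewrite 1 [← hm']
  group
namespace BraidGroup

/-- The generators of the braid group, extended by `1` to all natural indices. -/
def gen (n i : ℕ) : BraidGroup n := if h : i < n - 1 then braidσ n ⟨i, h⟩ else 1

theorem gen_of_le {n i : ℕ} (h : n - 1 ≤ i) : gen n i = 1 := by
  simp [gen, h.not_gt]

theorem gen_braid {n i : ℕ} (h : i + 1 < n - 1) :
    gen n i * gen n (i + 1) * gen n i = gen n (i + 1) * gen n i * gen n (i + 1) := by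
  have hi : i < n - 1 := by omega
  simp only [gen, h, hi, dif_pos, braidσ]
  exact PresentedGroup.mk_eq_mk_of_mul_inv_mem ⟨⟨i, hi⟩, ⟨i + 1, h⟩, Or.inl ⟨rfl, rfl⟩⟩

theorem gen_commute {n i j : ℕ} (h : i + 2 ≤ j) : Commute (gen n i) (gen n j) := by
  by_cases hj : j < n - 1
  · have hi : i < n - 1 := by omega
    simp only [gen, hj, hi, dif_pos, braidσ]
    exact PresentedGroup.mk_eq_mk_of_mul_inv_mem ⟨⟨i, hi⟩, ⟨j, hj⟩, Or.inr ⟨h, rfl⟩⟩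
  · rw [gen_of_le (not_lt.mp hj)]
    exact Commute.one_right _

theorem semiconjBy_gen {n i : ℕ} (h : i + 1 < n - 1) :
    SemiconjBy (gen n i * gen n (i + 1)) (gen n i) (gen n (i + 1)) := by
  rw [SemiconjBy, gen_braid h, mul_assoc]

theorem semiconjBy_gen' {n i : ℕ} (h : i + 1 < n - 1) :
    SemiconjBy (gen n (i + 1) * gen n i) (gen n (i + 1)) (gen n i) := by
  rw [SemiconjBy, ← gen_braid h, mul_assoc]

theorem closure_range_gen (n : ℕ) : Subgroup.closure (Set.range (gen n)) = ⊤ := by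
  rw [eq_top_iff, ← PresentedGroup.closure_range_of (braidRels (n - 1))]
  refine Subgroup.closure_mono ?_
  rintro _ ⟨i, rfl⟩
  exact ⟨i, by simp [gen, braidσ]⟩

/-- Homomorphisms out of the braid group. -/
def lift {G : Type*} [Group G] (n : ℕ) (f : ℕ → G)
    (hf : ∀ i, f i * f (i + 1) * f i = f (i + 1) * f i * f (i + 1))
    (hc : ∀ i j, i + 2 ≤ j → f i * f j = f j * f i) : BraidGroup n →* G :=
  PresentedGroup.toGroup (f := fun i : Fin (n - 1) => f i) (by
    rintro r ⟨i, j, ⟨h, rfl⟩ | ⟨h, rfl⟩⟩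
    · simp only [map_mul, map_inv, FreeGroup.lift_apply_of, ← h, hf, mul_inv_cancel]
    · simp only [map_mul, map_inv, FreeGroup.lift_apply_of, hc _ _ h, mul_inv_cancel])

theorem lift_gen {G : Type*} [Group G] {n : ℕ} (f : ℕ → G)
    (hf : ∀ i, f i * f (i + 1) * f i = f (i + 1) * f i * f (i + 1))
    (hc : ∀ i j, i + 2 ≤ j → f i * f j = f j * f i) {i : ℕ} (hi : i < n - 1) :
    lift n f hf hc (gen n i) = f i := by
  simp only [gen, hi, dif_pos, braidσ, lift]
  exact PresentedGroup.toGroup.of _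

/-- The permutation of the strands. -/
def perm (n : ℕ) : BraidGroup n →* Equiv.Perm ℕ :=
  lift n (fun i => Equiv.swap i (i + 1))
    (fun i => by
      ext x
      simp only [Equiv.Perm.mul_apply, Equiv.swap_apply_def]
      grind)
    (fun i j h => by
      ext x
      simp only [Equiv.Perm.mul_apply, Equiv.swap_apply_def]
      grind)

theorem perm_gen {n i : ℕ} (hi : i < n - 1) : perm n (gen n i) = Equiv.swap i (i + 1) :=
  lift_gen _ _ _ hi

theorem perm_gen_apply_of_lt {n i m : ℕ} (h : m < i) : perm n (gen n i) m = m := by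
  by_cases hi : i < n - 1
  · rw [perm_gen hi, Equiv.swap_apply_of_ne_of_ne] <;> omega
  · rw [gen_of_le (not_lt.mp hi), map_one, Equiv.Perm.one_apply]

theorem perm_gen_sq {n i : ℕ} : perm n (gen n i ^ 2) = 1 := by
  by_cases hi : i < n - 1
  · rw [map_pow, perm_gen hi, sq, Equiv.swap_mul_self]
  · rw [gen_of_le (not_lt.mp hi), one_pow, map_one]

/-- The exponent sum. -/
def expSum (n : ℕ) : BraidGroup n →* Multiplicative ℤ :=
  lift n (fun _ => Multiplicative.ofAdd 1) (fun _ => rfl) (fun _ _ _ => rfl)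

theorem expSum_gen {n i : ℕ} (hi : i < n - 1) : expSum n (gen n i) = Multiplicative.ofAdd 1 :=
  lift_gen _ _ _ hi

/-! ### Cosets of the stabilizer of a strand -/

/-- The braid `σ_{m+k-1} ⋯ σ_{m+1} σ_m`, which moves strand `m` to position `m + k`. -/
def transport (n m : ℕ) : ℕ → BraidGroup n
  | 0 => 1
  | k + 1 => gen n (m + k) * transport n m k

theorem perm_transport {n m k : ℕ} (h : m + k ≤ n - 1) : perm n (transport n m k) m = m + k := by
  induction k with
  | zero => simp [transport]
  | succ k ih =>
    rw [transport, map_mul, Equiv.Perm.mul_apply, ih (by omega), perm_gen (by omega),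
      Equiv.swap_apply_left, add_assoc]

theorem commute_gen_transport {n m k i : ℕ} (h : m + k < i) :
    Commute (gen n i) (transport n m k) := by
  induction k with
  | zero => exact Commute.one_right _
  | succ k ih => exact (gen_commute (by omega)).symm.mul_right (ih (by omega))

theorem gen_mul_transport {n m k i : ℕ} (hm : m ≤ i) (h : i + 2 ≤ m + k) (hk : m + k ≤ n - 1) :
    gen n i * transport n m k = transport n m k * gen n (i + 1) := by
  induction k with
  | zero => omega
  | succ k ih =>
    by_cases hi : i + 2 ≤ m + k
    · rw [transport, mul_assoc, ← ih hi (by omega), ← mul_assoc, ← mul_assoc,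
        (gen_commute hi).eq]
    · obtain ⟨k, rfl⟩ : ∃ l, k = l + 1 := ⟨k - 1, by omega⟩
      have h₁ : i = m + k := by omega
      subst h₁
      have h₂ := (commute_gen_transport (n := n) (m := m) (k := k) (i := m + k + 1)
        (by omega)).eq
      simp only [transport, ← add_assoc]
      calc gen n (m + k) * (gen n (m + k + 1) * (gen n (m + k) * transport n m k))
          = (gen n (m + k) * gen n (m + k + 1) * gen n (m + k)) * transport n m k := by
            simp only [mul_assoc]
        _ = gen n (m + k + 1) * (gen n (m + k) * (gen n (m + k + 1) * transport n m k)) := by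
            rw [gen_braid (by omega)]; simp only [mul_assoc]
        _ = _ := by rw [h₂]; simp only [mul_assoc]

theorem transport_conj_mem {n m : ℕ} {Q : Subgroup (BraidGroup n)} (h₀ : gen n m ^ 2 ∈ Q)
    (hQ : ∀ i, m < i → gen n i ∈ Q) {k : ℕ} (hk : m + k < n - 1) :
    (transport n m k)⁻¹ * gen n (m + k) ^ 2 * transport n m k ∈ Q := by
  induction k with
  | zero => simpa [transport] using h₀
  | succ k ih =>
    have h₁ := (commute_gen_transport (n := n) (m := m) (k := k) (i := m + k + 1)
      (by omega)).eq
    have h₂ := hQ (m + k + 1) (by omega)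
    have h₃ : SemiconjBy (gen n (m + k + 1) * gen n (m + k)) (gen n (m + k + 1) ^ 2)
        (gen n (m + k) ^ 2) := (semiconjBy_gen' (by omega)).pow_right 2
    have h₄ : (gen n (m + k))⁻¹ * gen n (m + k + 1) ^ 2 * gen n (m + k) =
        gen n (m + k + 1) * gen n (m + k) ^ 2 * (gen n (m + k + 1))⁻¹ := by
      have h₅ : SemiconjBy (gen n (m + k) * gen n (m + k + 1)) (gen n (m + k) ^ 2)
        (gen n (m + k + 1) ^ 2) := (semiconjBy_gen (by omega)).pow_right 2
      rw [eq_mul_inv_iff_mul_eq, mul_assoc, mul_assoc, inv_mul_eq_iff_eq_mul, ← mul_assoc,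
        ← mul_assoc, mul_assoc]
      exact h₅.eq.symm
    have h₆ : (transport n m (k + 1))⁻¹ * gen n (m + (k + 1)) ^ 2 * transport n m (k + 1) =
        gen n (m + k + 1) * ((transport n m k)⁻¹ * gen n (m + k) ^ 2 * transport n m k) *
          (gen n (m + k + 1))⁻¹ := by
      have h₇ : (transport n m k)⁻¹ * gen n (m + k + 1) =
          gen n (m + k + 1) * (transport n m k)⁻¹ := by
        rw [inv_mul_eq_iff_eq_mul, ← mul_assoc, ← h₁, mul_inv_cancel_right]
      have h₈ : (gen n (m + k + 1))⁻¹ * transport n m k =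
          transport n m k * (gen n (m + k + 1))⁻¹ := by
        rw [inv_mul_eq_iff_eq_mul, ← mul_assoc, h₁, mul_inv_cancel_right]
      calc _ = (transport n m k)⁻¹ * ((gen n (m + k))⁻¹ * gen n (m + k + 1) ^ 2 *
            gen n (m + k)) * transport n m k := by
            simp only [transport, mul_inv_rev, mul_assoc, add_assoc]
        _ = (transport n m k)⁻¹ * gen n (m + k + 1) * gen n (m + k) ^ 2 *
            ((gen n (m + k + 1))⁻¹ * transport n m k) := by
            rw [h₄]; simp only [mul_assoc]
        _ = _ := by rw [h₇, h₈]; simp only [mul_assoc]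
    rw [h₆]
    exact Q.mul_mem (Q.mul_mem h₂ (ih (by omega))) (Q.inv_mem h₂)

/-- A subgroup containing `σ_m²` and all `σ_i`, `i > m`, contains all braids in the `σ_i`, `i ≥ m`,
that fix strand `m`. -/
theorem mem_of_perm_eq {n m : ℕ} {Q : Subgroup (BraidGroup n)} (hm : m ≤ n - 1)
    (h₀ : gen n m ^ 2 ∈ Q) (hQ : ∀ i, m < i → gen n i ∈ Q) (hfix : ∀ q ∈ Q, perm n q m = m)
    {h : BraidGroup n} (hh : h ∈ Subgroup.closure {g | ∃ i, m ≤ i ∧ gen n i = g})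
    (hp : perm n h m = m) : h ∈ Q := by
  have key : ∃ k, m + k ≤ n - 1 ∧ ∃ q ∈ Q, h = transport n m k * q := by
    clear hp
    induction hh using Subgroup.closure_induction_left with
    | one => exact ⟨0, hm, 1, Q.one_mem, by simp [transport]⟩
    | mul_left x hx y _ ih =>
      obtain ⟨i, hi, rfl⟩ := hx
      obtain ⟨k, hk, q, hq, rfl⟩ := ih
      by_cases hin : n - 1 ≤ i
      · exact ⟨k, hk, q, hq, by rw [gen_of_le hin, one_mul]⟩
      rcases lt_trichotomy i (m + k) with hlt | rfl | hgt
      · by_cases hi2 : i + 2 ≤ m + k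
        · refine ⟨k, hk, gen n (i + 1) * q, Q.mul_mem (hQ _ (by omega)) hq, ?_⟩
          rw [← mul_assoc, gen_mul_transport hi hi2 hk, mul_assoc]
        · obtain ⟨l, rfl⟩ : ∃ l, k = l + 1 := ⟨k - 1, by omega⟩
          obtain rfl : i = m + l := by omega
          refine ⟨l, by omega, _, Q.mul_mem (transport_conj_mem h₀ hQ (k := l) (by omega)) hq, ?_⟩
          simp only [transport, sq]
          group
      · exact ⟨k + 1, by omega, q, hq, by rw [transport, mul_assoc]⟩
      · refine ⟨k, hk, gen n i * q, Q.mul_mem (hQ _ (by omega)) hq, ?_⟩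
        rw [← mul_assoc, (commute_gen_transport hgt).eq, mul_assoc]
    | inv_mul_cancel x hx y _ ih =>
      obtain ⟨i, hi, rfl⟩ := hx
      obtain ⟨k, hk, q, hq, rfl⟩ := ih
      by_cases hin : n - 1 ≤ i
      · exact ⟨k, hk, q, hq, by rw [gen_of_le hin, inv_one, one_mul]⟩
      rcases lt_trichotomy i (m + k) with hlt | rfl | hgt
      · by_cases hi2 : i + 2 ≤ m + k
        · refine ⟨k, hk, (gen n (i + 1))⁻¹ * q, Q.mul_mem (Q.inv_mem (hQ _ (by omega))) hq, ?_⟩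
          rw [inv_mul_eq_iff_eq_mul, ← mul_assoc, gen_mul_transport hi hi2 hk]
          group
        · obtain ⟨l, rfl⟩ : ∃ l, k = l + 1 := ⟨k - 1, by omega⟩
          obtain rfl : i = m + l := by omega
          exact ⟨l, by omega, q, hq, by simp only [transport]; group⟩
      · refine ⟨k + 1, by omega, _, Q.mul_mem (Q.inv_mem
          (transport_conj_mem h₀ hQ (k := k) (by omega))) hq, ?_⟩
        simp only [transport]
        group
      · refine ⟨k, hk, (gen n i)⁻¹ * q, Q.mul_mem (Q.inv_mem (hQ _ (by omega))) hq, ?_⟩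
        rw [← mul_assoc, ← mul_assoc, (commute_gen_transport hgt).inv_left.eq]
  obtain ⟨k, hk, q, hq, rfl⟩ := key
  rw [map_mul, Equiv.Perm.mul_apply, hfix q hq, perm_transport hk] at hp
  obtain rfl : k = 0 := by omega
  simpa [transport] using hq

/-! ### The free group of pushes of strand `0` -/

/-- The pure braid in which strand `0` goes around strand `j + 1`. -/
def push (n : ℕ) : ℕ → BraidGroup n
  | 0 => gen n 0 ^ 2
  | j + 1 => gen n (j + 1) * push n j * (gen n (j + 1))⁻¹

/-- The subgroup of braids in which only strand `0` moves. -/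
def pushSubgroup (n : ℕ) : Subgroup (BraidGroup n) :=
  Subgroup.closure (Set.range fun j : Fin (n - 1) => push n j)

theorem push_mem {n j : ℕ} (hj : j < n - 1) : push n j ∈ pushSubgroup n :=
  Subgroup.subset_closure ⟨⟨j, hj⟩, rfl⟩

theorem semiconjBy_push (n j : ℕ) : SemiconjBy (gen n (j + 1)) (push n j) (push n (j + 1)) := by
  rw [SemiconjBy, push, inv_mul_cancel_right]

theorem commute_gen_push_of_lt {n i j : ℕ} (h : j + 2 ≤ i) : Commute (gen n i) (push n j) := by
  induction j with
  | zero => exact (gen_commute h).symm.pow_right 2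
  | succ j ih =>
    have := (gen_commute (n := n) (i := j + 1) (j := i) (by omega)).symm
    exact (this.mul_right (ih (by omega))).mul_right this.inv_right

theorem semiconjBy_gen_mul_gen_push (n j : ℕ) :
    SemiconjBy (gen n (j + 1) * gen n (j + 2)) (push n j) (push n (j + 1)) :=
  (semiconjBy_push n j).mul_left (commute_gen_push_of_lt le_rfl)

theorem commute_gen_push_add_two {n j : ℕ} (h : j + 2 < n - 1) :
    Commute (gen n (j + 1)) (push n (j + 2)) := by
  have h₁ : push n (j + 2) =
      gen n (j + 2) * gen n (j + 1) * push n j * (gen n (j + 2) * gen n (j + 1))⁻¹ := by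
    simp only [push, mul_inv_rev, mul_assoc]
  have h₂ : gen n (j + 1) = gen n (j + 2) * gen n (j + 1) * gen n (j + 2) *
      (gen n (j + 2) * gen n (j + 1))⁻¹ :=
    eq_mul_inv_of_mul_eq (semiconjBy_gen' (i := j + 1) h).eq.symm
  rw [h₁]
  nth_rewrite 1 [h₂]
  exact (Commute.conj_iff _).mpr (commute_gen_push_of_lt le_rfl)

theorem commute_gen_push_of_gt {n i j : ℕ} (hi : 1 ≤ i) (h : i < j) (hj : j < n - 1) :
    Commute (gen n i) (push n j) := by
  induction j with
  | zero => omega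
  | succ j ih =>
    rcases Nat.lt_or_ge i j with hlt | hge
    · have := gen_commute (n := n) (i := i) (j := j + 1) (by omega)
      exact (this.mul_right (ih hlt (by omega))).mul_right this.inv_right
    · obtain rfl : i = j := by omega
      obtain ⟨i, rfl⟩ : ∃ l, i = l + 1 := ⟨i - 1, by omega⟩
      exact commute_gen_push_add_two hj

theorem commute_gen_push_mul_push {n j : ℕ} (h : j + 1 < n - 1) :
    Commute (gen n (j + 1)) (push n j * push n (j + 1)) := by
  induction j with
  | zero =>
    have h₁ : gen n 0 * gen n 1 * gen n 0 = gen n 1 * gen n 0 * gen n 1 := gen_braid h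
    have h₂ : push n 0 * push n (0 + 1) = gen n 0 * gen n 1 * gen n 1 * gen n 0 := by
      simp only [push, zero_add, sq]
      rw [← mul_assoc, mul_inv_eq_iff_eq_mul]
      calc gen n 0 * gen n 0 * (gen n 1 * (gen n 0 * gen n 0))
          = gen n 0 * (gen n 0 * gen n 1 * gen n 0) * gen n 0 := by simp only [mul_assoc]
        _ = gen n 0 * (gen n 1 * gen n 0 * gen n 1) * gen n 0 := by rw [h₁]
        _ = gen n 0 * gen n 1 * (gen n 0 * gen n 1 * gen n 0) := by simp only [mul_assoc]
        _ = _ := by rw [h₁]; simp only [mul_assoc]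
    rw [h₂, Commute, SemiconjBy]
    calc gen n 1 * (gen n 0 * gen n 1 * gen n 1 * gen n 0)
        = gen n 1 * gen n 0 * gen n 1 * (gen n 1 * gen n 0) := by simp only [mul_assoc]
      _ = gen n 0 * gen n 1 * (gen n 0 * gen n 1 * gen n 0) := by
        rw [← h₁]; simp only [mul_assoc]
      _ = _ := by rw [h₁]; simp only [mul_assoc, zero_add]
  | succ j ih =>
    have h₁ := semiconjBy_gen_mul_gen_push n j
    have h₂ : SemiconjBy (gen n (j + 1) * gen n (j + 2)) (push n (j + 1)) (push n (j + 2)) :=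
      SemiconjBy.mul_left (commute_gen_push_add_two h) (semiconjBy_push n (j + 1))
    have h₃ := semiconjBy_gen (n := n) (i := j + 1) h
    have h₄ := eq_mul_inv_of_mul_eq h₃.eq.symm
    have h₅ := eq_mul_inv_of_mul_eq (h₁.mul_right h₂).eq.symm
    rw [h₄, h₅]
    exact (Commute.conj_iff _).mpr (ih (by omega))

theorem gen_mem_normalizer {n i : ℕ} (hi : 1 ≤ i) :
    gen n i ∈ Subgroup.normalizer (pushSubgroup n : Set (BraidGroup n)) := by
  by_cases hin : n - 1 ≤ i
  · rw [gen_of_le hin]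
    exact Subgroup.one_mem _
  have h₁ : pushSubgroup n ≤
      (pushSubgroup n).comap (MulAut.conj (gen n i)).toMonoidHom := by
    rw [pushSubgroup, Subgroup.closure_le, ← pushSubgroup]
    rintro _ ⟨⟨j, hj⟩, rfl⟩
    change gen n i * push n j * (gen n i)⁻¹ ∈ pushSubgroup n
    rcases lt_trichotomy i j with hlt | rfl | hgt
    · rw [(commute_gen_push_of_gt hi hlt hj).eq, mul_inv_cancel_right]
      exact push_mem hj
    · obtain ⟨i, rfl⟩ : ∃ l, i = l + 1 := ⟨i - 1, by omega⟩
      have h₂ := (commute_gen_push_mul_push hj).eq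
      have h₃ : gen n (i + 1) * push n (i + 1) * (gen n (i + 1))⁻¹ =
          (push n (i + 1))⁻¹ * (push n i * push n (i + 1)) := by
        rw [eq_inv_mul_iff_mul_eq, ← mul_assoc, mul_inv_eq_iff_eq_mul, ← h₂, ← mul_assoc,
          ← mul_assoc, (semiconjBy_push n i).eq]
      rw [h₃]
      exact mul_mem (inv_mem (push_mem hj)) (mul_mem (push_mem (by omega)) (push_mem hj))
    · rcases Nat.lt_or_ge (j + 1) i with hlt | hge
      · rw [(commute_gen_push_of_lt hlt).eq, mul_inv_cancel_right]
        exact push_mem hj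
      · obtain rfl : i = j + 1 := by omega
        exact push_mem (n := n) (j := j + 1) (by omega)
  have h₁' : pushSubgroup n ≤
      (pushSubgroup n).comap (MulAut.conj (gen n i)⁻¹).toMonoidHom := by
    rw [pushSubgroup, Subgroup.closure_le, ← pushSubgroup]
    rintro _ ⟨⟨j, hj⟩, rfl⟩
    change (gen n i)⁻¹ * push n j * (gen n i)⁻¹⁻¹ ∈ pushSubgroup n
    rw [inv_inv]
    rcases lt_trichotomy i j with hlt | rfl | hgt
    · rw [mul_assoc, ← (commute_gen_push_of_gt hi hlt hj).eq, inv_mul_cancel_left]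
      exact push_mem hj
    · obtain ⟨i, rfl⟩ : ∃ l, i = l + 1 := ⟨i - 1, by omega⟩
      rw [mul_assoc, push, inv_mul_cancel_right, inv_mul_cancel_left]
      exact push_mem (by omega)
    · rcases Nat.lt_or_ge (j + 1) i with hlt | hge
      · rw [mul_assoc, ← (commute_gen_push_of_lt hlt).eq, inv_mul_cancel_left]
        exact push_mem hj
      · obtain rfl : i = j + 1 := by omega
        have hj' : j + 1 < n - 1 := by omega
        have h₂ := (commute_gen_push_mul_push hj').eq
        have h₃ : (gen n (j + 1))⁻¹ * push n j * gen n (j + 1) =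
            push n j * push n (j + 1) * (push n j)⁻¹ := by
          rw [eq_mul_inv_iff_mul_eq, mul_assoc, (semiconjBy_push n j).eq, mul_assoc,
            inv_mul_eq_iff_eq_mul, ← mul_assoc, h₂, mul_assoc]
        rw [h₃]
        exact mul_mem (mul_mem (push_mem hj) (push_mem hj')) (inv_mem (push_mem hj))
  rw [Subgroup.mem_normalizer_iff]
  refine fun h => ⟨fun hh => h₁ hh, fun hh => ?_⟩
  have := h₁' hh
  change (gen n i)⁻¹ * (gen n i * h * (gen n i)⁻¹) * (gen n i)⁻¹⁻¹ ∈ pushSubgroup n at this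
  simpa [mul_assoc] using this

theorem perm_push (n j : ℕ) : perm n (push n j) = 1 := by
  induction j with
  | zero => exact perm_gen_sq
  | succ j ih => rw [push, map_mul, map_mul, ih, mul_one, map_inv, mul_inv_cancel]

theorem perm_of_mem_pushSubgroup {n : ℕ} {u : BraidGroup n} (hu : u ∈ pushSubgroup n) :
    perm n u = 1 := by
  have : pushSubgroup n ≤ (perm n).ker := by
    rw [pushSubgroup, Subgroup.closure_le]
    rintro _ ⟨j, rfl⟩
    exact perm_push n j
  exact this hu

/-- Braids normalizing the pushes of strand `0`, commuting with `σ_0`, and fixing strand `1`. -/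
def pushComplement (n : ℕ) : Subgroup (BraidGroup n) :=
  Subgroup.normalizer (pushSubgroup n : Set (BraidGroup n)) ⊓
    Subgroup.centralizer {gen n 0} ⊓
    (MulAction.stabilizer (Equiv.Perm ℕ) 1).comap (perm n)

theorem mem_pushComplement {n : ℕ} {g : BraidGroup n} : g ∈ pushComplement n ↔
    g ∈ Subgroup.normalizer (pushSubgroup n : Set (BraidGroup n)) ∧
      g * gen n 0 = gen n 0 * g ∧ perm n g 1 = 1 := by
  rw [pushComplement, Subgroup.mem_inf, Subgroup.mem_inf, Subgroup.mem_centralizer_singleton_iff,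
    and_assoc]
  rfl

theorem mem_sup_of_perm_zero {n : ℕ} {h : BraidGroup n} (h₀ : perm n h 0 = 0) :
    ∃ u ∈ pushSubgroup n, ∃ v ∈ Subgroup.closure {g | ∃ i, 1 ≤ i ∧ gen n i = g}, h = u * v := by
  set B := Subgroup.closure {g | ∃ i, 1 ≤ i ∧ gen n i = g} with hB
  have hBN : B ≤ Subgroup.normalizer (pushSubgroup n : Set (BraidGroup n)) := by
    rw [hB, Subgroup.closure_le]
    rintro _ ⟨i, hi, rfl⟩
    exact gen_mem_normalizer hi
  have hle : pushSubgroup n ⊔ B ≤ (MulAction.stabilizer (Equiv.Perm ℕ) 0).comap (perm n) := by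
    refine sup_le (fun u hu => ?_) ?_
    · change perm n u 0 = 0
      rw [perm_of_mem_pushSubgroup hu, Equiv.Perm.one_apply]
    · rw [hB, Subgroup.closure_le]
      rintro _ ⟨i, hi, rfl⟩
      exact perm_gen_apply_of_lt hi
  have hsq : gen n 0 ^ 2 ∈ pushSubgroup n := by
    by_cases hn : 0 < n - 1
    · exact push_mem hn
    · rw [gen_of_le (not_lt.mp hn), one_pow]
      exact one_mem _
  have hgen : ∀ i, 0 < i → gen n i ∈ B := fun i hi => Subgroup.subset_closure ⟨i, hi, rfl⟩
  have hmem : h ∈ pushSubgroup n ⊔ B := by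
    refine mem_of_perm_eq (m := 0) (Nat.zero_le _) (Subgroup.mem_sup_left hsq)
      (fun i hi => Subgroup.mem_sup_right (hgen i hi))
      (fun q hq => hle hq) ?_ h₀
    have : {g | ∃ i, 0 ≤ i ∧ gen n i = g} = Set.range (gen n) := by
      ext; simp
    rw [this, closure_range_gen]
    trivial
  rw [← SetLike.mem_coe, Subgroup.coe_mul_of_right_le_normalizer_left _ _ hBN] at hmem
  obtain ⟨u, hu, v, hv, rfl⟩ := Set.mem_mul.mp hmem
  exact ⟨u, hu, v, hv, rfl⟩

theorem gen_one_sq_mem {n : ℕ} (hn : 1 < n - 1) :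
    gen n 1 ^ 2 ∈ pushSubgroup n ⊔ pushComplement n := by
  have h₁ : gen n 0 * gen n 1 * gen n 0 = gen n 1 * gen n 0 * gen n 1 := gen_braid hn
  have hT : push n 1 * gen n 1 ^ 2 ∈ pushComplement n := by
    refine mem_pushComplement.mpr ⟨mul_mem (Subgroup.le_normalizer (push_mem hn))
      (pow_mem (gen_mem_normalizer le_rfl) 2), ?_, ?_⟩
    · have h₂ : push n 1 * gen n 1 ^ 2 = gen n 1 * gen n 0 * gen n 0 * gen n 1 := by
        simp only [push, zero_add, sq]
        group
      rw [h₂]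
      calc gen n 1 * gen n 0 * gen n 0 * gen n 1 * gen n 0
          = gen n 1 * gen n 0 * (gen n 0 * gen n 1 * gen n 0) := by simp only [mul_assoc]
        _ = (gen n 1 * gen n 0 * gen n 1) * gen n 0 * gen n 1 := by
          rw [h₁]; simp only [mul_assoc]
        _ = _ := by rw [← h₁]; simp only [mul_assoc]
    · rw [map_mul, perm_push, perm_gen_sq]
      rfl
  have h₂ := mul_mem (Subgroup.mem_sup_left (T := pushComplement n)
    (inv_mem (push_mem (n := n) hn))) (Subgroup.mem_sup_right (S := pushSubgroup n) hT)
  rwa [inv_mul_cancel_left] at h₂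

theorem exists_push_of_perm {n : ℕ} (hn : 1 < n - 1) {h : BraidGroup n} (h₀ : perm n h 0 = 0)
    (h₁ : perm n h 1 = 1) :
    ∃ u ∈ pushSubgroup n, h * gen n 0 * h⁻¹ = u * gen n 0 * u⁻¹ := by
  obtain ⟨u, hu, v, hv, rfl⟩ := mem_sup_of_perm_zero h₀
  rw [map_mul, perm_of_mem_pushSubgroup hu, one_mul] at h₁
  have hmem : v ∈ pushSubgroup n ⊔ pushComplement n := by
    refine mem_of_perm_eq (m := 1) hn.le (gen_one_sq_mem hn) (fun i hi => ?_) ?_ hv h₁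
    · exact Subgroup.mem_sup_right (mem_pushComplement.mpr ⟨gen_mem_normalizer hi.le,
        (gen_commute (by omega)).symm.eq, perm_gen_apply_of_lt hi⟩)
    · have hle : pushSubgroup n ⊔ pushComplement n ≤
          (MulAction.stabilizer (Equiv.Perm ℕ) 1).comap (perm n) := by
        refine sup_le (fun u hu => ?_) fun q hq => (mem_pushComplement.mp hq).2.2
        change perm n u 1 = 1
        rw [perm_of_mem_pushSubgroup hu, Equiv.Perm.one_apply]
      exact fun q hq => hle hq
  rw [← SetLike.mem_coe, Subgroup.coe_mul_of_right_le_normalizer_left _ _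
    fun q hq => (mem_pushComplement.mp hq).1] at hmem
  obtain ⟨w, hw, c, hc, rfl⟩ := Set.mem_mul.mp hmem
  obtain ⟨-, hc, -⟩ := mem_pushComplement.mp hc
  refine ⟨u * w, mul_mem hu hw, ?_⟩
  calc u * (w * c) * gen n 0 * (u * (w * c))⁻¹
      = u * w * (c * gen n 0) * c⁻¹ * w⁻¹ * u⁻¹ := by simp only [mul_inv_rev, mul_assoc]
    _ = _ := by rw [hc]; simp only [mul_inv_rev, mul_assoc, mul_inv_cancel_left]

/-- A half-twist exchanging strands `0` and `1` is conjugate to `σ_0` by a push of strand `0`. -/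
theorem exists_push_of_perm_eq {n : ℕ} (hn : 1 < n - 1) {h : BraidGroup n}
    (hp : perm n (h * gen n 0 * h⁻¹) = perm n (gen n 0)) :
    ∃ u ∈ pushSubgroup n, h * gen n 0 * h⁻¹ = u * gen n 0 * u⁻¹ := by
  have hg : perm n (gen n 0) = Equiv.swap 0 1 := perm_gen (by omega)
  rw [map_mul, map_mul, map_inv, hg, mul_inv_eq_iff_eq_mul] at hp
  have e₀ : perm n h 1 = Equiv.swap 0 1 (perm n h 0) := by
    simpa using congrArg (fun f : Equiv.Perm ℕ => f 0) hp
  have hne : perm n h 1 ≠ perm n h 0 := fun e => by simpa using (perm n h).injective e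
  have hcases : perm n h 0 = 0 ∨ perm n h 0 = 1 := by
    by_contra! hcon
    exact hne (e₀.trans (Equiv.swap_apply_of_ne_of_ne hcon.1 hcon.2))
  rcases hcases with e | e
  · exact exists_push_of_perm hn e (by rw [e₀, e, Equiv.swap_apply_left])
  · have := exists_push_of_perm hn (h := h * gen n 0)
      (by rw [map_mul, hg, Equiv.Perm.mul_apply, Equiv.swap_apply_left, e₀, e,
        Equiv.swap_apply_right])
      (by rw [map_mul, hg, Equiv.Perm.mul_apply, Equiv.swap_apply_right, e])
    simpa [mul_assoc] using this

/-! ### The action on the free group -/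

/-- The endomorphism of the free group on `ℕ` underlying the action of `σ_i`. -/
def artinHom (i : ℕ) : FreeGroup ℕ →* FreeGroup ℕ :=
  FreeGroup.lift fun j => if j = i then FreeGroup.of (i + 1) else
    if j = i + 1 then (FreeGroup.of (i + 1))⁻¹ * FreeGroup.of i * FreeGroup.of (i + 1) else
      FreeGroup.of j

/-- The inverse of `artinHom`. -/
def artinInv (i : ℕ) : FreeGroup ℕ →* FreeGroup ℕ :=
  FreeGroup.lift fun j => if j = i then FreeGroup.of i * FreeGroup.of (i + 1) * (FreeGroup.of i)⁻¹
    else if j = i + 1 then FreeGroup.of i else FreeGroup.of j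

theorem artinHom_of_self (i : ℕ) : artinHom i (FreeGroup.of i) = FreeGroup.of (i + 1) := by
  simp [artinHom]

theorem artinHom_of_succ (i : ℕ) : artinHom i (FreeGroup.of (i + 1)) =
    (FreeGroup.of (i + 1))⁻¹ * FreeGroup.of i * FreeGroup.of (i + 1) := by
  simp [artinHom]

theorem artinHom_of_ne {i j : ℕ} (h₀ : j ≠ i) (h₁ : j ≠ i + 1) :
    artinHom i (FreeGroup.of j) = FreeGroup.of j := by
  simp [artinHom, h₀, h₁]

/-- The automorphism by which `σ_i` acts on the free group on `ℕ`. -/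
def artinAut (i : ℕ) : MulAut (FreeGroup ℕ) :=
  MonoidHom.toMulEquiv (artinHom i) (artinInv i)
    (by
      ext j
      by_cases h₀ : j = i
      · subst h₀; simp [artinHom, artinInv]
      by_cases h₁ : j = i + 1
      · subst h₁; simp [artinHom, artinInv, mul_assoc]
      · simp [artinHom, artinInv, h₀, h₁])
    (by
      ext j
      by_cases h₀ : j = i
      · subst h₀; simp [artinHom, artinInv, mul_assoc]
      by_cases h₁ : j = i + 1
      · subst h₁; simp [artinHom, artinInv]
      · simp [artinHom, artinInv, h₀, h₁])

theorem artinAut_apply (i : ℕ) (x : FreeGroup ℕ) : artinAut i x = artinHom i x := rfl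

theorem mulAut_ext_of {f g : MulAut (FreeGroup ℕ)}
    (h : ∀ j, f (FreeGroup.of j) = g (FreeGroup.of j)) : f = g := by
  have : f.toMonoidHom = g.toMonoidHom := FreeGroup.ext_hom _ _ h
  exact MulEquiv.toMonoidHom_injective this

/-- Artin's action of the braid group on a free group. -/
def artin (n : ℕ) : BraidGroup n →* MulAut (FreeGroup ℕ) :=
  lift n artinAut
    (fun i => mulAut_ext_of fun j => by
      simp only [MulAut.mul_apply, artinAut_apply]
      have e₀ : artinHom i (FreeGroup.of (i + 1 + 1)) = FreeGroup.of (i + 1 + 1) :=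
        artinHom_of_ne (by omega) (by omega)
      have e₁ : artinHom (i + 1) (FreeGroup.of i) = FreeGroup.of i :=
        artinHom_of_ne (by omega) (by omega)
      by_cases h₀ : j = i
      · subst h₀
        simp only [artinHom_of_self, e₀, e₁]
      by_cases h₁ : j = i + 1
      · subst h₁
        simp only [artinHom_of_self, artinHom_of_succ, map_mul, map_inv, e₀, e₁]
      by_cases h₂ : j = i + 1 + 1
      · subst h₂
        simp only [artinHom_of_self, artinHom_of_succ, map_mul, map_inv, e₀, e₁]
        group
      · simp only [artinHom_of_ne h₀ h₁, artinHom_of_ne h₁ h₂])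
    (fun i j h => mulAut_ext_of fun l => by
      simp only [MulAut.mul_apply, artinAut_apply, artinHom, FreeGroup.lift_apply_of]
      grind [FreeGroup.lift_apply_of])

theorem artin_gen {n i : ℕ} (hi : i < n - 1) : artin n (gen n i) = artinAut i :=
  lift_gen _ _ _ hi

/-- The endomorphism of the free group killing the `0`-th generator. -/
def kill : FreeGroup ℕ →* FreeGroup ℕ :=
  FreeGroup.lift fun j => if j = 0 then 1 else FreeGroup.of j

theorem kill_zero : kill (FreeGroup.of 0) = 1 := by simp [kill]

theorem kill_succ (j : ℕ) : kill (FreeGroup.of (j + 1)) = FreeGroup.of (j + 1) := by simp [kill]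

theorem kill_artinAut_succ (i : ℕ) (x : FreeGroup ℕ) :
    kill (artinAut (i + 1) x) = artinAut (i + 1) (kill x) := by
  have : kill.comp (artinAut (i + 1)).toMonoidHom = (artinAut (i + 1)).toMonoidHom.comp kill := by
    ext j
    change kill (artinHom (i + 1) (FreeGroup.of j)) = artinHom (i + 1) (kill (FreeGroup.of j))
    rcases j with _ | j
    · rw [artinHom_of_ne (by omega) (by omega), kill_zero, map_one]
    · rw [kill_succ]
      by_cases h₀ : j = i
      · subst h₀; rw [artinHom_of_self, kill_succ]
      by_cases h₁ : j = i + 1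
      · subst h₁; simp only [artinHom_of_succ, map_mul, map_inv, kill_succ]
      · rw [artinHom_of_ne (by omega) (by omega), kill_succ]
  exact DFunLike.congr_fun this x

theorem kill_artin_push {n j : ℕ} (hj : j < n - 1) (x : FreeGroup ℕ) :
    kill (artin n (push n j) x) = kill x := by
  induction j generalizing x with
  | zero =>
    rw [push, map_pow, artin_gen hj]
    have : kill.comp (artinAut 0 ^ 2).toMonoidHom = kill := by
      ext l
      change kill (artinHom 0 (artinHom 0 (FreeGroup.of l))) = kill (FreeGroup.of l)
      rcases l with _ | _ | l
      · rw [artinHom_of_self, artinHom_of_succ]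
        simp only [map_mul, map_inv, kill_zero, mul_one, inv_mul_cancel]
      · rw [artinHom_of_succ]
        simp only [map_mul, map_inv, artinHom_of_self, artinHom_of_succ, kill_zero, kill_succ,
          mul_one, inv_mul_cancel, one_mul, inv_one]
      · rw [artinHom_of_ne (by omega) (by omega), artinHom_of_ne (by omega) (by omega)]
    exact DFunLike.congr_fun this x
  | succ j ih =>
    rw [push, map_mul, map_mul, map_inv, artin_gen hj, MulAut.mul_apply, MulAut.mul_apply,
      kill_artinAut_succ, ih (by omega), ← kill_artinAut_succ, MulAut.apply_inv_self]

theorem artin_push_of_zero {n j : ℕ} (hj : j < n - 1) :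
    artin n (push n j) (FreeGroup.of 0) =
      (FreeGroup.of (j + 1))⁻¹ * FreeGroup.of 0 * FreeGroup.of (j + 1) := by
  induction j with
  | zero =>
    rw [push, map_pow, artin_gen hj, sq, MulAut.mul_apply, artinAut_apply, artinAut_apply,
      artinHom_of_self, artinHom_of_succ]
  | succ j ih =>
    have h₀ : artinAut (j + 1) (FreeGroup.of 0) = FreeGroup.of 0 :=
      artinHom_of_ne (i := j + 1) (j := 0) (by omega) (by omega)
    have h₁ : (artinAut (j + 1))⁻¹ (FreeGroup.of 0) = FreeGroup.of 0 := by
      nth_rewrite 1 [← h₀]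
      rw [MulAut.inv_apply_self]
    rw [push, map_mul, map_mul, map_inv, artin_gen hj, MulAut.mul_apply, MulAut.mul_apply, h₁,
      ih (by omega), map_mul, map_mul, map_inv, h₀, artinAut_apply, artinHom_of_self]

/-- The parametrization of the pushes of strand `0` by a free group. -/
def pushHom (n : ℕ) : FreeGroup (Fin (n - 1)) →* BraidGroup n :=
  FreeGroup.lift fun j => push n j

theorem pushHom_of {n : ℕ} (j : Fin (n - 1)) : pushHom n (FreeGroup.of j) = push n j :=
  FreeGroup.lift_apply_of

theorem range_pushHom (n : ℕ) : (pushHom n).range = pushSubgroup n :=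
  FreeGroup.range_lift_eq_closure

theorem kill_artin_pushHom {n : ℕ} (f : FreeGroup (Fin (n - 1))) (x : FreeGroup ℕ) :
    kill (artin n (pushHom n f) x) = kill x := by
  induction f generalizing x with
  | C1 => simp
  | of j => rw [pushHom_of, kill_artin_push j.2]
  | inv_of j ih =>
    rw [← ih, map_inv, map_inv, MulAut.apply_inv_self]
  | mul f g hf hg => rw [map_mul, map_mul, MulAut.mul_apply, hf, hg]

theorem exists_artin_pushHom {n : ℕ} (f : FreeGroup (Fin (n - 1))) :
    ∃ w, artin n (pushHom n f) (FreeGroup.of 0) = w * FreeGroup.of 0 * w⁻¹ ∧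
      kill w = FreeGroup.map (fun j : Fin (n - 1) => (j : ℕ) + 1) f⁻¹ := by
  induction f with
  | C1 => exact ⟨1, by simp⟩
  | of j =>
    refine ⟨(FreeGroup.of (j + 1))⁻¹, ?_, ?_⟩
    · rw [pushHom_of, artin_push_of_zero j.2, inv_inv]
    · rw [map_inv, map_inv, kill_succ, FreeGroup.map.of]
  | inv_of j ih =>
    obtain ⟨w, hw, hk⟩ := ih
    refine ⟨artin n (pushHom n (FreeGroup.of j)⁻¹) w⁻¹, ?_, ?_⟩
    · have : FreeGroup.of 0 = artin n (pushHom n (FreeGroup.of j)⁻¹)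
          (w * FreeGroup.of 0 * w⁻¹) := by
        rw [← hw, map_inv, map_inv, MulAut.inv_apply_self]
      nth_rewrite 2 [this]
      simp only [map_mul, map_inv]
      group
    · rw [kill_artin_pushHom, map_inv, hk, map_inv _ (FreeGroup.of j)⁻¹]
  | mul f g hf hg =>
    obtain ⟨v, hv, hkv⟩ := hf
    obtain ⟨w, hw, hkw⟩ := hg
    refine ⟨artin n (pushHom n f) w * v, ?_, ?_⟩
    · rw [map_mul, map_mul, MulAut.mul_apply, hw, map_mul, map_mul, hv, map_inv]
      group
    · rw [map_mul, kill_artin_pushHom, hkv, hkw, mul_inv_rev, map_mul]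

/-- The pushes of strand `0` form a free group. -/
theorem pushHom_injective (n : ℕ) : Function.Injective (pushHom n) := by
  rw [injective_iff_map_eq_one]
  intro f hf
  obtain ⟨w, hw, hk⟩ := exists_artin_pushHom f
  rw [hf, map_one, MulAut.one_apply, eq_mul_inv_iff_mul_eq] at hw
  obtain ⟨m, rfl⟩ := FreeGroup.exists_eq_zpow_of_commute_zpow 0 one_ne_zero (w := w)
    (by rw [zpow_one]; exact hw.symm)
  rw [map_zpow, kill_zero, one_zpow, eq_comm, ← map_one (FreeGroup.map _)] at hk
  have := FreeGroup.map_injective (fun a b h => Fin.ext (Nat.succ_injective h)) hk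
  simpa using this

/-! ### The action on integer functions -/

/-- The rank one operator `v ↦ f v • w`. -/
def rankOne (f : (ℕ → ℤ) →ₗ[ℤ] ℤ) (w : ℕ → ℤ) : Module.End ℤ (ℕ → ℤ) := f.smulRight w

theorem rankOne_apply (f : (ℕ → ℤ) →ₗ[ℤ] ℤ) (w p : ℕ → ℤ) : rankOne f w p = f p • w := rfl

/-- The square-zero operator `N` for which `σ_i` acts as `1 - N`. -/
def transvection (i : ℕ) : Module.End ℤ (ℕ → ℤ) :=
  rankOne ((LinearMap.proj (i + 1) : (ℕ → ℤ) →ₗ[ℤ] ℤ) - LinearMap.proj i)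
    (Pi.single i 1 + Pi.single (i + 1) 1)

theorem transvection_apply (i : ℕ) (p : ℕ → ℤ) (x : ℕ) :
    transvection i p x = if x = i ∨ x = i + 1 then p (i + 1) - p i else 0 := by
  simp only [transvection, rankOne_apply, LinearMap.sub_apply, LinearMap.proj_apply, Pi.smul_apply,
    Pi.add_apply, Pi.single_apply, smul_eq_mul]
  grind

theorem transvection_mul_self (i : ℕ) : transvection i * transvection i = 0 := by
  ext p x
  simp [Module.End.mul_apply, transvection_apply]

/-- The action of `σ_i` on integer functions. -/
def burauUnit (i : ℕ) : (Module.End ℤ (ℕ → ℤ))ˣ where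
  val := 1 - transvection i
  inv := 1 + transvection i
  val_inv := by
    rw [sub_mul, mul_add, mul_add, transvection_mul_self]; simp
  inv_val := by
    rw [add_mul, mul_sub, mul_sub, transvection_mul_self]; simp

theorem burauUnit_apply (i : ℕ) (p : ℕ → ℤ) (x : ℕ) :
    (burauUnit i : Module.End ℤ (ℕ → ℤ)) p x =
      p x - if x = i ∨ x = i + 1 then p (i + 1) - p i else 0 := by
  rw [← transvection_apply]; rfl

/-- The Burau representation at parameter `-1`. -/
def burau (n : ℕ) : BraidGroup n →* (Module.End ℤ (ℕ → ℤ))ˣ :=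
  lift n burauUnit
    (fun i => by
      refine Units.ext (LinearMap.ext fun p => funext fun x => ?_)
      simp only [Units.val_mul, Module.End.mul_apply, burauUnit_apply]
      grind)
    (fun i j h => by
      refine Units.ext (LinearMap.ext fun p => funext fun x => ?_)
      simp only [Units.val_mul, Module.End.mul_apply, burauUnit_apply]
      grind)

theorem burau_gen {n i : ℕ} (hi : i < n - 1) : burau n (gen n i) = burauUnit i :=
  lift_gen _ _ _ hi

theorem burau_apply_perm {n : ℕ} (h : BraidGroup n) (p : ℕ → ℤ) (x : ℕ) :
    (burau n h : Module.End ℤ (ℕ → ℤ)) p (perm n h x) ≡ p x [ZMOD 2] := by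
  have hh : h ∈ Subgroup.closure (Set.range (gen n)) := by
    rw [closure_range_gen]; trivial
  have hgen : ∀ i, ∀ p x, (burau n (gen n i) : Module.End ℤ (ℕ → ℤ)) p (perm n (gen n i) x) ≡ p x
      [ZMOD 2] := by
    intro i p x
    by_cases hi : i < n - 1
    · rw [burau_gen hi, perm_gen hi, burauUnit_apply, Equiv.swap_apply_def]
      rw [Int.modEq_iff_dvd]
      split_ifs <;> grind
    · rw [gen_of_le (not_lt.mp hi), map_one, map_one]
      rfl
  induction hh using Subgroup.closure_induction generalizing p x with
  | mem g hg =>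
    obtain ⟨i, rfl⟩ := hg
    exact hgen i p x
  | one => rw [map_one, map_one]; rfl
  | mul g h _ _ hg hh =>
    rw [map_mul, map_mul, Units.val_mul, Module.End.mul_apply, Equiv.Perm.mul_apply]
    exact (hg _ _).trans (hh _ _)
  | inv g _ hg =>
    have := hg ((burau n g⁻¹ : Module.End ℤ (ℕ → ℤ)) p) (perm n g⁻¹ x)
    rw [← Equiv.Perm.mul_apply, ← map_mul, mul_inv_cancel, map_one, Equiv.Perm.one_apply,
      map_inv (burau n), ← Module.End.mul_apply, Units.mul_inv, Module.End.one_apply] at this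
    rw [map_inv (burau n)]
    exact this.symm

theorem perm_eq_of_burau_eq {n : ℕ} {g h : BraidGroup n} (e : burau n g = burau n h) :
    perm n g = perm n h := by
  ext x
  have h₁ := burau_apply_perm g (Pi.single x 1) x
  have h₂ := burau_apply_perm h (Pi.single x 1) ((perm n h)⁻¹ (perm n g x))
  rw [e] at h₁
  rw [← Equiv.Perm.mul_apply, mul_inv_cancel, Equiv.Perm.one_apply] at h₂
  have h₃ := h₁.symm.trans h₂
  rw [Pi.single_eq_same, Pi.single_apply] at h₃
  split_ifs at h₃ with hx
  · rw [Equiv.Perm.inv_eq_iff_eq] at hx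
    exact hx
  · exact absurd h₃ (by decide)

theorem _root_.Units.val_zpow_of_val_eq_one_sub {R : Type*} [Ring R] {u : Rˣ} {x : R}
    (hu : (u : R) = 1 - x) (hx : x * x = 0) (k : ℤ) : ((u ^ k : Rˣ) : R) = 1 - k • x := by
  have hinv : ((u⁻¹ : Rˣ) : R) = 1 + x := by
    rw [Units.inv_eq_of_mul_eq_one_right]
    rw [hu, sub_mul, mul_add, mul_add, hx]; simp
  induction k with
  | zero => simp
  | succ k ih =>
    rw [zpow_add_one, Units.val_mul, ih, hu, sub_mul, mul_sub, smul_mul_assoc, mul_sub, hx]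
    simp only [mul_one, one_mul, sub_zero, add_smul, one_smul]
    abel
  | pred k ih =>
    rw [zpow_sub_one, Units.val_mul, ih, hinv, sub_mul, mul_add, smul_mul_assoc, mul_add, hx]
    simp only [mul_one, one_mul, add_zero, sub_smul, one_smul]
    abel

/-- If `k`-th powers of two half-twists satisfy the braid relation, then `k = ±1` or the half-twists
have the same image in the Burau representation at `-1`. -/
theorem burau_eq_or_of_braid {n : ℕ} (hn : 0 < n - 1) {h : BraidGroup n} {k : ℤ} (hk : k ≠ 0)
    (hrel : gen n 0 ^ k * (h * gen n 0 * h⁻¹) ^ k * gen n 0 ^ k =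
      (h * gen n 0 * h⁻¹) ^ k * gen n 0 ^ k * (h * gen n 0 * h⁻¹) ^ k) :
    burau n (h * gen n 0 * h⁻¹) = burau n (gen n 0) ∨ k = 1 ∨ k = -1 := by
  set N := transvection 0 with hN
  set H : Module.End ℤ (ℕ → ℤ) := (burau n h : Module.End ℤ (ℕ → ℤ)) with hH
  set H' : Module.End ℤ (ℕ → ℤ) :=
    (((burau n h)⁻¹ : (Module.End ℤ (ℕ → ℤ))ˣ) : Module.End ℤ (ℕ → ℤ)) with hH'
  have hHH : H' * H = 1 := Units.inv_mul _
  have hHH' : H * H' = 1 := Units.mul_inv _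
  set M := H * N * H' with hM
  have hNN : N * N = 0 := transvection_mul_self 0
  have hMM : M * M = 0 := by
    calc M * M = H * N * (H' * H) * N * H' := by simp only [hM, mul_assoc]
      _ = H * (N * N) * H' := by rw [hHH, mul_one, mul_assoc H]
      _ = 0 := by rw [hNN, mul_zero, zero_mul]
  have ha : (burau n (gen n 0) : Module.End ℤ (ℕ → ℤ)) = 1 - N := by
    rw [burau_gen hn]; rfl
  have hb : (burau n (h * gen n 0 * h⁻¹) : Module.End ℤ (ℕ → ℤ)) = 1 - M := by
    rw [map_mul, map_mul, map_inv, Units.val_mul, Units.val_mul, ha, ← hH, ← hH', mul_sub, sub_mul,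
      mul_one, hHH']
  obtain ⟨f, w, hfw⟩ : ∃ f w, N = rankOne f w := ⟨_, _, rfl⟩
  set c : ℤ := f (H w) * f (H' w) with hc
  have hNMN : N * M * N = c • N := by
    ext1 p
    simp only [hM, hfw, Module.End.mul_apply, rankOne_apply, map_smul, LinearMap.smul_apply,
      smul_smul]
    congr 1
    ring
  have hMNM : M * N * M = c • M := by
    have h₁ : M * N * M = H * (N * H' * N * H * N) * H' := by simp only [hM, mul_assoc]
    have h₂ : N * H' * N * H * N = c • N := by
      ext1 p
      simp only [hfw, Module.End.mul_apply, rankOne_apply, map_smul, LinearMap.smul_apply,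
        smul_smul]
      congr 1
      ring
    rw [h₁, h₂, mul_smul_comm, smul_mul_assoc]
  have key : (k * (1 + k ^ 2 * c)) • (M - N) = 0 := by
    have e := congrArg (fun g => (burau n g : Module.End ℤ (ℕ → ℤ))) hrel
    rw [map_mul, map_mul, map_mul, map_mul, map_zpow, map_zpow, Units.val_mul, Units.val_mul,
      Units.val_mul, Units.val_mul, Units.val_zpow_of_val_eq_one_sub ha hNN,
      Units.val_zpow_of_val_eq_one_sub hb hMM] at e
    simp only [mul_sub, sub_mul, mul_one, one_mul, smul_mul_assoc, mul_smul_comm, smul_sub, hNN,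
      hMM, hNMN, hMNM, smul_zero] at e
    have e' := sub_eq_zero.mpr e
    rw [← e']
    module
  rcases smul_eq_zero.mp key with h0 | h0
  · right
    have h1 : k * (-(k * c)) = 1 := by
      have := (mul_eq_zero.mp h0).resolve_left hk
      linarith
    exact Int.isUnit_iff.mp (IsUnit.of_mul_eq_one _ h1)
  · left
    exact Units.ext (by rw [ha, hb, sub_eq_zero.mp h0])

/-- If powers of `σ_0` and of a conjugate by a push of strand `0` satisfy the braid relation, then
the two half-twists coincide. -/
theorem conj_gen_eq_of_braid {n : ℕ} (hn : 1 < n - 1) {u : BraidGroup n} (hu : u ∈ pushSubgroup n)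
    {k : ℤ} (hk : k ≠ 0)
    (hrel : gen n 0 ^ k * (u * gen n 0 * u⁻¹) ^ k * gen n 0 ^ k =
      (u * gen n 0 * u⁻¹) ^ k * gen n 0 ^ k * (u * gen n 0 * u⁻¹) ^ k) :
    u * gen n 0 * u⁻¹ = gen n 0 := by
  set s := gen n 0 with hs
  set b := u * s * u⁻¹ with hb
  set c := s ^ k with hc
  set d := b ^ k with hd
  have hpb : perm n b = perm n s := by
    rw [hb, map_mul, map_mul, perm_of_mem_pushSubgroup hu, one_mul, map_inv,
      perm_of_mem_pushSubgroup hu, inv_one, mul_one]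
  have hcb : c * b * c⁻¹ = c * u * s * (c * u)⁻¹ := by
    simp only [hb, mul_inv_rev, mul_assoc]
  obtain ⟨v, hv, hcv⟩ : ∃ v ∈ pushSubgroup n, c * b * c⁻¹ = v * s * v⁻¹ := by
    rw [hcb]
    refine exists_push_of_perm_eq hn ?_
    rw [← hs, ← hcb, map_mul, map_mul, hpb, map_inv, hc, map_zpow]
    group
  rw [← range_pushHom] at hu hv
  obtain ⟨γ, hγ⟩ := hu
  obtain ⟨γ', hγ'⟩ := hv
  set x : Fin (n - 1) := ⟨0, by omega⟩ with hx
  have hs2 : pushHom n (FreeGroup.of x) = s ^ 2 := pushHom_of x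
  have hX : pushHom n (FreeGroup.of x ^ k) = c ^ 2 := by
    rw [map_zpow, hs2, hc, ← zpow_natCast, ← zpow_natCast, ← zpow_mul, ← zpow_mul, mul_comm]
  have hconj : pushHom n (γ * FreeGroup.of x ^ k * γ⁻¹) = d ^ 2 := by
    rw [map_mul, map_mul, map_inv, hX, hγ, hd, hb, conj_zpow, conj_pow]
  have hconj' : pushHom n (γ' * FreeGroup.of x ^ k * γ'⁻¹) = c * d ^ 2 * c⁻¹ := by
    rw [map_mul, map_mul, map_inv, hX, hγ', hd, ← conj_pow, ← conj_pow (a := c), ← conj_zpow,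
      ← conj_zpow (a := c), hcv]
  set ζ := γ * FreeGroup.of x ^ k * γ⁻¹ * (γ' * FreeGroup.of x ^ k * γ'⁻¹) * FreeGroup.of x ^ k
    with hζ
  have hζZ : pushHom n ζ = (c * d * c) * (c * d * c) := by
    rw [hζ, map_mul, map_mul, hconj, hconj', hX]
    calc d ^ 2 * (c * d ^ 2 * c⁻¹) * c ^ 2 = d * (d * c * d) * d * c := by
          simp only [sq]; group
      _ = d * (c * d * c) * d * c := by rw [hrel]
      _ = d * c * d * (c * d * c) := by simp only [mul_assoc]
      _ = _ := by rw [hrel]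
  have hΔc : SemiconjBy (c * d * c) c d := by
    rw [SemiconjBy]
    nth_rewrite 1 [hrel]
    simp only [mul_assoc]
  have hΔd : SemiconjBy (c * d * c) d c := by
    rw [SemiconjBy]
    nth_rewrite 2 [hrel]
    simp only [mul_assoc]
  clear_value ζ
  have h₁ : Commute ζ (FreeGroup.of x ^ k) := by
    apply pushHom_injective n
    rw [map_mul, map_mul, hζZ, hX]
    exact ((hΔd.mul_left hΔc).pow_right 2).eq
  have h₂ : Commute ζ (γ * FreeGroup.of x ^ k * γ⁻¹) := by
    apply pushHom_injective n
    rw [map_mul, map_mul (pushHom n) _ ζ, hζZ, hconj]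
    exact ((hΔc.mul_left hΔd).pow_right 2).eq
  have hζ1 : ζ ≠ 1 := by
    intro h
    rw [h, map_one] at hζZ
    have e := congrArg (fun g => Multiplicative.toAdd (expSum n g)) hζZ
    have es : expSum n s = Multiplicative.ofAdd 1 := expSum_gen (by omega)
    simp only [hc, hd, hb, map_mul, map_zpow, map_inv, es, map_one, toAdd_mul, toAdd_zpow,
      toAdd_inv, toAdd_ofAdd, toAdd_one, smul_eq_mul] at e
    apply hk
    linarith
  obtain ⟨m, hm⟩ := FreeGroup.exists_eq_zpow_of_commute_conj x hk h₁ h₂ hζ1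
  have hus : Commute u s := by
    rw [← hγ, hm, map_zpow, hs2]
    exact ((Commute.refl s).pow_left 2).zpow_left m
  rw [hb, hus.eq, mul_inv_cancel_right]

end BraidGroup

/-- For `n ≥ 4` and distinct half-twists `a, b` in `B_n`, if
`a^j b^k a^j = b^k a^j b^k` with `j, k` nonzero, then `j = k = 1` or `j = k = -1`. -/
theorem braidGroup_halfTwist_braid_relation (n : ℕ) (hn : 4 ≤ n)
    (a b : BraidGroup n)
    (ha : IsConj (braidσ n ⟨0, by omega⟩) a)
    (hb : IsConj (braidσ n ⟨0, by omega⟩) b)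
    (hab : a ≠ b)
    (j k : ℤ) (hj : j ≠ 0) (hk : k ≠ 0)
    (h : a ^ j * b ^ k * a ^ j = b ^ k * a ^ j * b ^ k) :
    (j = 1 ∧ k = 1) ∨ (j = -1 ∧ k = -1) := by
  have hlt : 0 < n - 1 := by omega
  have hs : braidσ n ⟨0, by omega⟩ = BraidGroup.gen n 0 := by
    simp [BraidGroup.gen, hlt]
  rw [hs] at ha hb
  obtain ⟨g, rfl⟩ := isConj_iff.mp ha
  obtain ⟨g', rfl⟩ := isConj_iff.mp hb
  obtain rfl : j = k := by
    have e := congrArg (fun x => Multiplicative.toAdd (BraidGroup.expSum n x)) h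
    simp only [map_mul, map_zpow, map_inv, BraidGroup.expSum_gen hlt, toAdd_mul, toAdd_zpow,
      toAdd_inv, toAdd_ofAdd, smul_eq_mul] at e
    linarith
  set s := BraidGroup.gen n 0 with hs'
  set f := g⁻¹ * g' with hf
  have hg' : g' = g * f := by rw [hf, mul_inv_cancel_left]
  have hb' : g' * s * g'⁻¹ = g * (f * s * f⁻¹) * g⁻¹ := by
    rw [hg', mul_inv_rev]; simp only [mul_assoc]
  rw [hb'] at h hab
  have hrel : s ^ j * (f * s * f⁻¹) ^ j * s ^ j =
      (f * s * f⁻¹) ^ j * s ^ j * (f * s * f⁻¹) ^ j := by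
    have hp : ∀ x : BraidGroup n, (g * x * g⁻¹) ^ j = g * x ^ j * g⁻¹ := fun _ => conj_zpow
    rw [hp s, hp (f * s * f⁻¹), conj_mul, conj_mul, conj_mul, conj_mul] at h
    exact mul_left_cancel (mul_right_cancel h)
  rcases BraidGroup.burau_eq_or_of_braid hlt hk hrel with e | e | e
  · exfalso
    have hn' : 1 < n - 1 := by omega
    obtain ⟨u, hu, hfu⟩ :=
      BraidGroup.exists_push_of_perm_eq hn' (BraidGroup.perm_eq_of_burau_eq e)
    rw [← hs'] at hfu
    rw [hfu] at hrel hab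
    exact hab (by rw [BraidGroup.conj_gen_eq_of_braid hn' hu hk hrel])
  · exact Or.inl ⟨e, e⟩
  · exact Or.inr ⟨e, e⟩
end

section
/- The group B_3/Z(B_3), the quotient of the braid group on 3 strands by its center, is not co-Hopfian: there exists an injective group endomorphism of B_3/Z(B_3) which is not surjective. -/
namespace Monoid.CoprodI

open scoped Cardinal

section Words

variable {ι : Type*} {G : ι → Type*} [∀ i, Group (G i)]

theorem NeWord.index_eq_of_prod_eq {i j k l : ι} (u : NeWord G i j) (v : NeWord G k l)
    (h : u.prod = v.prod) : i = k ∧ j = l := by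
  classical
  have hw : u.toWord = v.toWord := Word.equiv.symm.injective h
  have hl : u.toList = v.toList := congrArg Word.toList hw
  have hh := u.toList_head?
  have ht := u.toList_getLast?
  rw [hl] at hh ht
  rw [v.toList_head?] at hh
  rw [v.toList_getLast?] at ht
  simp only [Option.some.injEq, Sigma.mk.injEq] at hh ht
  exact ⟨hh.1.symm, ht.1.symm⟩

theorem NeWord.prod_notMem_center_of_ne [∀ i, Nontrivial (G i)] {i j k : ι} (w : NeWord G i j)
    (hi : k ≠ i) (hj : k ≠ j) : w.prod ∉ Subgroup.center (CoprodI G) := by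
  intro hw
  obtain ⟨m, hm⟩ := exists_ne (1 : G k)
  refine hi (index_eq_of_prod_eq (append (singleton m hm) hi w)
    (append w hj.symm (singleton m hm)) ?_).1
  simpa using Subgroup.mem_center_iff.1 hw (of m)

theorem NeWord.prod_notMem_center_of_three_le {i j : ι} (w : NeWord G i j)
    (hij : i ≠ j) (hcard : 3 ≤ #(G i)) : w.prod ∉ Subgroup.center (CoprodI G) := by
  intro hw
  obtain ⟨m, hm, hmw⟩ := Cardinal.exists_ne_ne_of_three_le hcard 1 w.head⁻¹
  have hne : m * w.head ≠ 1 := fun h => hmw (eq_inv_of_mul_eq_one_left h)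
  refine hij (index_eq_of_prod_eq (mulHead w m hne)
    (append w hij.symm (singleton m hm)) ?_).2.symm
  simpa using Subgroup.mem_center_iff.1 hw (of m)

/-- A free product of nontrivial groups, one of which has at least three elements, is
centerless. -/
theorem center_eq_bot [Nontrivial ι] [∀ i, Nontrivial (G i)] (hcard : ∃ i, 3 ≤ #(G i)) :
    Subgroup.center (CoprodI G) = ⊥ := by
  classical
  rw [eq_bot_iff]
  intro z hz
  rw [Subgroup.mem_bot]
  by_contra hz1
  obtain ⟨w, rfl⟩ := Word.equiv.symm.surjective z
  change w.prod ∈ _ at hz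
  obtain ⟨i, j, w, rfl⟩ := NeWord.of_word w (by rintro rfl; exact hz1 Word.prod_empty)
  change w.prod ∈ _ at hz
  obtain ⟨k, hk⟩ := hcard
  by_cases hij : i = j
  · subst hij
    obtain ⟨l, hl⟩ := exists_ne i
    exact w.prod_notMem_center_of_ne hl hl hz
  by_cases hki : k = i
  · subst hki
    exact w.prod_notMem_center_of_three_le hij hk hz
  by_cases hkj : k = j
  · subst hkj
    refine w.inv.prod_notMem_center_of_three_le (Ne.symm hij) hk ?_
    rw [NeWord.inv_prod]
    exact inv_mem hz
  · exact w.prod_notMem_center_of_ne hki hkj hz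

theorem Word.fstIdx_of_smul [DecidableEq ι] [∀ i, DecidableEq (G i)] {i : ι} {m : G i}
    (hm : m ≠ 1) {w : Word G} (hw : w.fstIdx ≠ some i) : (of m • w).fstIdx = some i := by
  have h : of m • w = Word.cons m w hw hm := (Word.cons_eq_smul (h1 := hw) (h2 := hm)).symm
  rw [h, Word.fstIdx_cons]

end Words

end Monoid.CoprodI

open Monoid Monoid.CoprodI

/-- The homomorphism from the cyclic group of order `n` sending the generator to `g`. -/
def zmodPowHom {N : Type*} [Group N] (n : ℕ) (g : N) (hg : g ^ n = 1) :
    Multiplicative (ZMod n) →* N :=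
  AddMonoidHom.toMultiplicativeLeft
    (ZMod.lift n ⟨zmultiplesHom (Additive N) (Additive.ofMul g), by
      simp [← ofMul_pow, hg]⟩)

theorem zmodPowHom_ofAdd_one {N : Type*} [Group N] (n : ℕ) (g : N) (hg : g ^ n = 1) :
    zmodPowHom n g hg (Multiplicative.ofAdd 1) = g := by
  have h := ZMod.lift_coe n ⟨zmultiplesHom (Additive N) (Additive.ofMul g), by
      simp [← ofMul_pow, hg]⟩ 1
  simp only [Int.cast_one] at h
  change Additive.toMul (ZMod.lift n _ 1) = g
  rw [h]
  simp

theorem multiplicativeZMod_hom_ext {N : Type*} [Group N] {n : ℕ}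
    {f g : Multiplicative (ZMod n) →* N}
    (h : f (Multiplicative.ofAdd 1) = g (Multiplicative.ofAdd 1)) : f = g := by
  refine MonoidHom.ext fun x => ?_
  obtain ⟨k, hk⟩ := ZMod.intCast_surjective x.toAdd
  have hx : x = Multiplicative.ofAdd (1 : ZMod n) ^ k := by
    rw [← ofAdd_zsmul, zsmul_one, hk, ofAdd_toAdd]
  rw [hx, map_zpow, map_zpow, h]

/-- The cyclic groups of order two and three. -/
abbrev CyclicTwoThree (i : Fin 2) : Type := Multiplicative (ZMod ((i : ℕ) + 2))

/-- The free product of cyclic groups of order two and three. -/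
abbrev ModularFreeProduct : Type := CoprodI CyclicTwoThree

namespace ModularFreeProduct

/-- The generator of order two. -/
def a : ModularFreeProduct := of (M := CyclicTwoThree) (i := 0) (Multiplicative.ofAdd 1)

/-- The generator of order three. -/
def b : ModularFreeProduct := of (M := CyclicTwoThree) (i := 1) (Multiplicative.ofAdd 1)

theorem a_sq : a ^ 2 = 1 := by
  rw [a, ← map_pow, ← map_one of]
  rfl

theorem b_cube : b ^ 3 = 1 := by
  rw [b, ← map_pow, ← map_one of]
  rfl

theorem hom_ext {N : Type*} [Group N] {f g : ModularFreeProduct →* N}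
    (ha : f a = g a) (hb : f b = g b) : f = g := by
  refine CoprodI.ext_hom _ _ fun i => multiplicativeZMod_hom_ext ?_
  fin_cases i
  exacts [ha, hb]

/-- The homomorphism determined by an element of order dividing two and one of order dividing
three. -/
def homOfPow {N : Type*} [Group N] (x y : N) (hx : x ^ 2 = 1) (hy : y ^ 3 = 1) :
    ModularFreeProduct →* N :=
  lift fun i => zmodPowHom ((i : ℕ) + 2) (![x, y] i) (by fin_cases i; exacts [hx, hy])

section

variable {N : Type*} [Group N] {x y : N} (hx : x ^ 2 = 1) (hy : y ^ 3 = 1)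

@[simp]
theorem homOfPow_a : homOfPow x y hx hy a = x := by
  rw [homOfPow, a, lift_of, zmodPowHom_ofAdd_one]
  rfl

@[simp]
theorem homOfPow_b : homOfPow x y hx hy b = y := by
  rw [homOfPow, b, lift_of, zmodPowHom_ofAdd_one]
  rfl

end

instance (i : Fin 2) : Nontrivial (CyclicTwoThree i) :=
  haveI : Fact (1 < (i : ℕ) + 2) := ⟨by omega⟩
  inferInstanceAs (Nontrivial (Multiplicative (ZMod ((i : ℕ) + 2))))

theorem exists_three_le_card : ∃ i, 3 ≤ Cardinal.mk (CyclicTwoThree i) := by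
  refine ⟨1, ?_⟩
  have h : Fintype.card (Multiplicative (ZMod 3)) = 3 := rfl
  change 3 ≤ Cardinal.mk (Multiplicative (ZMod 3))
  rw [Cardinal.mk_fintype, h]
  rfl

/-- The inclusions of the factors, the one of order three being twisted by conjugation
by `b * a`. -/
def twistedInclusion (i : Fin 2) : CyclicTwoThree i →* ModularFreeProduct :=
  (MulAut.conj (![1, b * a] i)).toMonoidHom.comp of

/-- The endomorphism fixing `a` and conjugating `b` by `b * a`. -/
def twist : ModularFreeProduct →* ModularFreeProduct := lift twistedInclusion

theorem twist_a : twist a = a := by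
  rw [twist, a, lift_of]
  simp [twistedInclusion]

theorem twist_b : twist b = (b * a) * b * (b * a)⁻¹ := by
  rw [twist, b, lift_of]
  simp [twistedInclusion, b, mul_assoc]

theorem twist_injective : Function.Injective twist := by
  classical
  have h0 : (Multiplicative.ofAdd 1 : CyclicTwoThree 0) ≠ 1 := by decide
  have h1 : (Multiplicative.ofAdd 1 : CyclicTwoThree 1) ≠ 1 := by decide
  refine lift_injective_of_ping_pong twistedInclusion (Or.inr exists_three_le_card)
    (fun i => {w : Word CyclicTwoThree | w.fstIdx = some i}) ?_ ?_ ?_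
  · intro i
    obtain ⟨m, hm⟩ := exists_ne (1 : CyclicTwoThree i)
    exact ⟨_, Word.fstIdx_of_smul hm (w := Word.empty) (by simp [Word.fstIdx, Word.empty])⟩
  · intro i j hij
    refine Set.disjoint_left.2 fun w hi hj => hij ?_
    exact Option.some.inj (Eq.trans (Eq.symm hi) hj)
  · intro i j hij m hm
    rintro _ ⟨w, hw, rfl⟩
    simp only [Set.mem_ofPred_eq] at hw ⊢
    fin_cases i <;> fin_cases j <;> try exact absurd rfl hij
    · simpa [twistedInclusion] using Word.fstIdx_of_smul hm (w := w) (by simp [hw])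
    · have key : twistedInclusion 1 m • w = b • a • of m • a⁻¹ • b⁻¹ • w := by
        simp [twistedInclusion, mul_smul]
      have e1 : (b⁻¹ • w).fstIdx = some 1 := by
        rw [b, ← map_inv]
        exact Word.fstIdx_of_smul (inv_ne_one.2 h1) (by simp [hw])
      have e2 : (a⁻¹ • b⁻¹ • w).fstIdx = some 0 := by
        rw [a, ← map_inv]
        exact Word.fstIdx_of_smul (inv_ne_one.2 h0) (by simp [e1])
      have e3 := Word.fstIdx_of_smul hm (w := a⁻¹ • b⁻¹ • w) (by simp [e2])
      have e4 := Word.fstIdx_of_smul h0 (w := of m • a⁻¹ • b⁻¹ • w) (by rw [e3]; simp)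
      have e5 := Word.fstIdx_of_smul h1 (w := a • of m • a⁻¹ • b⁻¹ • w)
        (by rw [show (a • of m • a⁻¹ • b⁻¹ • w).fstIdx = some 0 from e4]; simp)
      exact (congrArg Word.fstIdx key).trans e5

theorem twist_not_surjective : ¬ Function.Surjective twist := by
  intro hs
  let x : Equiv.Perm (Fin 4) := Equiv.swap 2 3
  let y : Equiv.Perm (Fin 4) := Equiv.swap 0 1 * Equiv.swap 1 2
  have hx : x ^ 2 = 1 := by decide
  have hy : y ^ 3 = 1 := by decide
  let H : Subgroup (Equiv.Perm (Fin 4)) := MulAction.stabilizer _ (0 : Fin 4)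
  have hxH : x ∈ H := MulAction.mem_stabilizer_iff.2 (by decide)
  have hyH : (y * x) * y * (y * x)⁻¹ ∈ H := MulAction.mem_stabilizer_iff.2 (by decide)
  have hle : H.subtype.comp (homOfPow (⟨x, hxH⟩ : H) ⟨_, hyH⟩ (Subtype.ext hx)
      (Subtype.ext (by rw [SubmonoidClass.coe_pow, conj_pow, hy]; simp))) =
        (homOfPow x y hx hy).comp twist := by
    apply hom_ext
    · simp [twist_a]
    · simp [twist_b]
  obtain ⟨g, hg⟩ := hs b
  have hb : (homOfPow x y hx hy).comp twist g ∈ H := by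
    rw [← hle]
    exact Subtype.property _
  rw [MonoidHom.comp_apply, hg, homOfPow_b] at hb
  exact absurd (MulAction.mem_stabilizer_iff.1 hb) (by decide)

end ModularFreeProduct

namespace BraidGroup

open ModularFreeProduct

/-- The first generator of the braid group on three strands. -/
def s₁ : BraidGroup 3 := braidσ 3 0

/-- The second generator of the braid group on three strands. -/
def s₂ : BraidGroup 3 := braidσ 3 1

theorem braid_relation : s₁ * s₂ * s₁ = s₂ * s₁ * s₂ := by
  rw [← mul_inv_eq_one]
  exact PresentedGroup.one_of_mem (rels := braidRels 2) ⟨0, 1, Or.inl ⟨rfl, rfl⟩⟩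

theorem hom_ext {N : Type*} [Group N] {f g : BraidGroup 3 →* N}
    (h₁ : f s₁ = g s₁) (h₂ : f s₂ = g s₂) : f = g := by
  refine PresentedGroup.ext fun i => ?_
  fin_cases i
  exacts [h₁, h₂]

/-- The square of the half twist is central. -/
theorem halfTwist_sq_mem_center : (s₁ * s₂ * s₁) ^ 2 ∈ Subgroup.center (BraidGroup 3) := by
  have h₁ : s₁ * s₂ * s₁ * s₁ = s₂ * (s₁ * s₂ * s₁) := by
    nth_rewrite 1 [braid_relation]
    simp only [mul_assoc]
  have h₂ : s₁ * s₂ * s₁ * s₂ = s₁ * (s₁ * s₂ * s₁) := by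
    nth_rewrite 2 [braid_relation]
    simp only [mul_assoc]
  have hc : (MulAut.conj ((s₁ * s₂ * s₁) ^ 2)).toMonoidHom = MonoidHom.id _ := by
    generalize s₁ * s₂ * s₁ = d at h₁ h₂ ⊢
    apply hom_ext
    · change d ^ 2 * s₁ * (d ^ 2)⁻¹ = s₁
      rw [mul_inv_eq_iff_eq_mul, sq, mul_assoc, h₁, ← mul_assoc, h₂, mul_assoc]
    · change d ^ 2 * s₂ * (d ^ 2)⁻¹ = s₂
      rw [mul_inv_eq_iff_eq_mul, sq, mul_assoc, h₂, ← mul_assoc, h₁, mul_assoc]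
  refine Subgroup.mem_center_iff.2 fun g => ?_
  exact (mul_inv_eq_iff_eq_mul.1 (DFunLike.congr_fun hc g)).symm

theorem cube_eq_sq : (s₁ * s₂) ^ 3 = (s₁ * s₂ * s₁) ^ 2 := by
  calc (s₁ * s₂) ^ 3 = s₁ * s₂ * s₁ * (s₂ * s₁ * s₂) := by simp only [pow_three, mul_assoc]
    _ = (s₁ * s₂ * s₁) ^ 2 := by rw [← braid_relation, sq]

/-- The map from the free product to the braid group modulo its center. -/
def ofFreeProduct : ModularFreeProduct →* BraidGroup 3 ⧸ Subgroup.center (BraidGroup 3) :=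
  homOfPow (QuotientGroup.mk (s₁ * s₂ * s₁)) (QuotientGroup.mk (s₁ * s₂))
    (by
      rw [← QuotientGroup.mk_pow]
      exact (QuotientGroup.eq_one_iff _).2 halfTwist_sq_mem_center)
    (by
      rw [← QuotientGroup.mk_pow, cube_eq_sq]
      exact (QuotientGroup.eq_one_iff _).2 halfTwist_sq_mem_center)

/-- The map from the braid group to the free product of cyclic groups. -/
def toFreeProductAux : BraidGroup 3 →* ModularFreeProduct :=
  PresentedGroup.toGroup (f := ![b⁻¹ * a, a * b⁻¹]) (by
    rintro r ⟨i, j, ⟨hij, rfl⟩ | ⟨hij, rfl⟩⟩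
    · obtain rfl : i = 0 := Fin.ext (by simp; omega)
      obtain rfl : j = 1 := Fin.ext (by simp; omega)
      have haa (g : ModularFreeProduct) : a * (a * g) = g := by
        rw [← mul_assoc, ← sq, a_sq, one_mul]
      have hbb (g : ModularFreeProduct) : b⁻¹ * (b⁻¹ * (b⁻¹ * g)) = g := by
        rw [← mul_assoc, ← mul_assoc, ← pow_three', inv_pow, b_cube, inv_one, one_mul]
      rw [map_mul, map_inv, mul_inv_eq_one]
      simpa [mul_assoc, haa, hbb] using hbb 1
    · omega)

theorem toFreeProductAux_s₁ : toFreeProductAux s₁ = b⁻¹ * a := PresentedGroup.toGroup.of _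

theorem toFreeProductAux_s₂ : toFreeProductAux s₂ = a * b⁻¹ := PresentedGroup.toGroup.of _

theorem toFreeProductAux_delta : toFreeProductAux (s₁ * s₂) = b := by
  rw [map_mul, toFreeProductAux_s₁, toFreeProductAux_s₂]
  calc b⁻¹ * a * (a * b⁻¹) = b⁻¹ * a ^ 2 * b⁻¹ := by simp only [sq, mul_assoc]
    _ = b⁻¹ * b ^ 3 * b⁻¹ := by rw [a_sq, b_cube]
    _ = b := by group

theorem toFreeProductAux_halfTwist : toFreeProductAux (s₁ * s₂ * s₁) = a := by
  rw [map_mul, toFreeProductAux_delta, toFreeProductAux_s₁, mul_inv_cancel_left]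

theorem toFreeProductAux_surjective : Function.Surjective toFreeProductAux := by
  let H := toFreeProductAux.range
  have h : H.subtype.comp (homOfPow (⟨a, _, toFreeProductAux_halfTwist⟩ : H)
      ⟨b, _, toFreeProductAux_delta⟩ (Subtype.ext a_sq) (Subtype.ext b_cube)) =
        MonoidHom.id _ := by
    apply ModularFreeProduct.hom_ext <;> simp
  intro g
  change g ∈ H
  rw [← MonoidHom.id_apply _ g, ← h]
  exact Subtype.property _

theorem toFreeProductAux_eq_one_of_mem_center {z : BraidGroup 3}
    (hz : z ∈ Subgroup.center (BraidGroup 3)) : toFreeProductAux z = 1 := by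
  rw [← Subgroup.mem_bot, ← CoprodI.center_eq_bot exists_three_le_card, Subgroup.mem_center_iff]
  intro g
  obtain ⟨x, rfl⟩ := toFreeProductAux_surjective g
  rw [← map_mul, ← map_mul, Subgroup.mem_center_iff.1 hz x]

/-- The map from the braid group modulo its center to the free product. -/
def toFreeProduct : BraidGroup 3 ⧸ Subgroup.center (BraidGroup 3) →* ModularFreeProduct :=
  QuotientGroup.lift _ toFreeProductAux fun _ => toFreeProductAux_eq_one_of_mem_center

/-- The braid group on three strands modulo its center is the free product of cyclic groups of
order two and three. -/
def quotientCenterEquiv :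
    BraidGroup 3 ⧸ Subgroup.center (BraidGroup 3) ≃* ModularFreeProduct :=
  MonoidHom.toMulEquiv toFreeProduct ofFreeProduct
    (by
      refine QuotientGroup.monoidHom_ext _ (BraidGroup.hom_ext ?_ ?_)
      · change ofFreeProduct (toFreeProductAux s₁) = QuotientGroup.mk s₁
        rw [toFreeProductAux_s₁, map_mul, map_inv, ofFreeProduct, homOfPow_a, homOfPow_b,
          ← QuotientGroup.mk_inv, ← QuotientGroup.mk_mul, inv_mul_cancel_left]
      · change ofFreeProduct (toFreeProductAux s₂) = QuotientGroup.mk s₂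
        rw [toFreeProductAux_s₂, map_mul, map_inv, ofFreeProduct, homOfPow_a, homOfPow_b,
          ← QuotientGroup.mk_inv, ← QuotientGroup.mk_mul, braid_relation, mul_assoc s₂,
          mul_inv_cancel_right])
    (by
      apply ModularFreeProduct.hom_ext
      · rw [MonoidHom.comp_apply, ofFreeProduct, homOfPow_a]
        exact toFreeProductAux_halfTwist
      · rw [MonoidHom.comp_apply, ofFreeProduct, homOfPow_b]
        exact toFreeProductAux_delta)

end BraidGroup

open BraidGroup ModularFreeProduct in
/-- `B_3/Z(B_3)` is not co-Hopfian: it admits an injective endomorphism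
which is not surjective. -/
theorem braidThreeModCenter_not_coHopfian :
    ∃ ρ : BraidGroup 3 ⧸ Subgroup.center (BraidGroup 3) →*
          BraidGroup 3 ⧸ Subgroup.center (BraidGroup 3),
      Function.Injective ρ ∧ ¬ Function.Surjective ρ := by
  refine ⟨quotientCenterEquiv.symm.toMonoidHom.comp
    (twist.comp quotientCenterEquiv.toMonoidHom), ?_, fun hs => twist_not_surjective ?_⟩
  · exact quotientCenterEquiv.symm.injective.comp
      (twist_injective.comp quotientCenterEquiv.injective)
  · intro g
    obtain ⟨x, hx⟩ := hs (quotientCenterEquiv.symm g)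
    exact ⟨quotientCenterEquiv x, quotientCenterEquiv.symm.injective hx⟩
end
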